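/- arXiv:2103.08075 — 7 statements merged into one kernel-verified Lean document; each statement's English description precedes it below -/
import Mathlib

section
/- Let X be a separable Banach space (over ℝ or ℂ), T a bounded linear operator on X, and ε ∈ (0,1). Let D₁ be a dense subset of X, and let D₂ = {y_k : k ∈ ℕ} be a countable subset of X (with a fixed enumeration) such that for every x ∈ X \ {0} there are infinitely many k ∈ ℕ with ‖y_k − x‖ ≤ ε‖x‖. Suppose there exist an increasing sequence (n(k))_k of natural numbers and maps S_{n(k)} : D₂ → X such that (1) lim_{k→∞} ‖T^{n(k)} x‖ = 0 for all x ∈ D₁, (2) lim_{k→∞} ‖S_{n(k)} y_k‖ = 0, and (3) lim_{k→∞} ‖T^{n(k)} S_{n(k)} y_k − y_k‖ = 0. Then T is δ-hypercyclic for every δ > ε. -/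
open Filter Topology

/-- The set of vectors whose orbit meets the open ball of radius `r` around `z` is open. -/
lemma isOpen_setOf_exists_norm_pow_apply_sub_lt
    {𝕜 X : Type*} [RCLike 𝕜] [NormedAddCommGroup X] [NormedSpace 𝕜 X]
    (T : X →L[𝕜] X) (z : X) (r : ℝ) :
    IsOpen {x : X | ∃ m : ℕ, ‖(T ^ m) x - z‖ < r} := by
  rw [Set.ofPred_exists]
  exact isOpen_iUnion fun m => isOpen_lt (by fun_prop) continuous_const

/-- If infinitely many `y k` are within `c` of `z`, then, under the conditions of the
criterion, the set of vectors whose orbit comes within `r > c` of `z` is dense. -/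
lemma dense_setOf_exists_norm_pow_apply_sub_lt
    {𝕜 X : Type*} [RCLike 𝕜] [NormedAddCommGroup X] [NormedSpace 𝕜 X]
    (T : X →L[𝕜] X) {D₁ : Set X} (hD₁ : Dense D₁) (y : ℕ → X) (n : ℕ → ℕ) (v : ℕ → X)
    (h1 : ∀ x ∈ D₁, Tendsto (fun k => ‖(T ^ n k) x‖) atTop (𝓝 0))
    (h2 : Tendsto (fun k => ‖v k‖) atTop (𝓝 0))
    (h3 : Tendsto (fun k => ‖(T ^ n k) (v k) - y k‖) atTop (𝓝 0))
    {z : X} {c r : ℝ} (hcr : c < r) (hz : {k : ℕ | ‖y k - z‖ ≤ c}.Infinite) :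
    Dense {x : X | ∃ m : ℕ, ‖(T ^ m) x - z‖ < r} := by
  refine Dense.of_closure (hD₁.mono fun u hu => ?_)
  have hpos : 0 < (r - c) / 2 := by linarith
  rw [Metric.mem_closure_iff]
  intro η hη
  obtain ⟨k, hk, hk1, hk2, hk3⟩ := ((Nat.frequently_atTop_iff_infinite.2 hz).and_eventually
    (((h1 u hu).eventually (gt_mem_nhds hpos)).and
      ((h2.eventually (gt_mem_nhds hη)).and (h3.eventually (gt_mem_nhds hpos))))).exists
  refine ⟨u + v k, ⟨n k, ?_⟩, by simpa [dist_eq_norm] using hk2⟩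
  have hsplit : (T ^ n k) (u + v k) - z =
      (T ^ n k) u + ((T ^ n k) (v k) - y k) + (y k - z) := by
    rw [map_add]; abel
  rw [hsplit]
  have := norm_add₃_le (a := (T ^ n k) u) (b := (T ^ n k) (v k) - y k) (c := y k - z)
  have hk : ‖y k - z‖ ≤ c := hk
  linarith

/-- **ε-Hypercyclicity Criterion.** Let `X` be a separable Banach space over `ℝ` or `ℂ`,
`T` a bounded operator on `X`, `ε ∈ (0,1)`, `D₁` dense, and `y : ℕ → X` an enumeration of a
countable set `D₂` such that every nonzero `x` has infinitely many `k` with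
`‖y k - x‖ ≤ ε * ‖x‖`. If there are an increasing sequence `n` and maps `S (n k) : D₂ → X`
with the three stated limit conditions, then `T` is `δ`-hypercyclic for every `δ > ε`. -/
theorem epsilon_hypercyclicity_criterion
    {𝕜 X : Type*} [RCLike 𝕜] [NormedAddCommGroup X] [NormedSpace 𝕜 X]
    [CompleteSpace X] [TopologicalSpace.SeparableSpace X]
    (T : X →L[𝕜] X) {ε : ℝ} (hε : ε ∈ Set.Ioo (0 : ℝ) 1)
    (D₁ : Set X) (hD₁ : Dense D₁)
    (y : ℕ → X)
    (hy : ∀ x : X, x ≠ 0 → {k : ℕ | ‖y k - x‖ ≤ ε * ‖x‖}.Infinite)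
    (n : ℕ → ℕ) (hn : StrictMono n)
    (S : ℕ → X → X)
    (h1 : ∀ x ∈ D₁, Tendsto (fun k => ‖(T ^ n k) x‖) atTop (𝓝 0))
    (h2 : Tendsto (fun k => ‖S k (y k)‖) atTop (𝓝 0))
    (h3 : Tendsto (fun k => ‖(T ^ n k) (S k (y k)) - y k‖) atTop (𝓝 0)) :
    ∀ δ : ℝ, ε < δ →
      ∃ x : X, ∀ z : X, z ≠ 0 → ∃ m : ℕ, ‖(T ^ m) x - z‖ ≤ δ * ‖z‖ := by
  intro δ hδ
  obtain ⟨ρ, hερ, hρδ⟩ := exists_between hδ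
  obtain ⟨s, hs, hsd⟩ := TopologicalSpace.exists_countable_dense X
  have hdense : Dense (⋂ w ∈ s ∩ {0}ᶜ, {x : X | ∃ m : ℕ, ‖(T ^ m) x - w‖ < ρ * ‖w‖}) := by
    refine dense_biInter_of_isOpen
      (fun w _ => isOpen_setOf_exists_norm_pow_apply_sub_lt T w _)
      (hs.mono Set.inter_subset_left) fun w hw => ?_
    exact dense_setOf_exists_norm_pow_apply_sub_lt T hD₁ y n _ h1 h2 h3
      (mul_lt_mul_of_pos_right hερ (norm_pos_iff.2 hw.2)) (hy w hw.2)
  obtain ⟨x, hx⟩ := hdense.nonempty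
  refine ⟨x, fun z hz => ?_⟩
  have hopen : IsOpen ({w : X | ρ * ‖w‖ + ‖w - z‖ < δ * ‖z‖} ∩ {0}ᶜ) :=
    (isOpen_lt (by fun_prop) continuous_const).inter isOpen_compl_singleton
  have hmem : z ∈ {w : X | ρ * ‖w‖ + ‖w - z‖ < δ * ‖z‖} ∩ {0}ᶜ :=
    ⟨by simpa using mul_lt_mul_of_pos_right hρδ (norm_pos_iff.2 hz), hz⟩
  obtain ⟨w, ⟨hwz, hw0⟩, hws⟩ := hsd.inter_open_nonempty _ hopen ⟨z, hmem⟩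
  obtain ⟨m, hm⟩ := Set.mem_iInter₂.1 hx w ⟨hws, hw0⟩
  refine ⟨m, ?_⟩
  have := norm_sub_le_norm_sub_add_norm_sub ((T ^ m) x) w z
  have hwz : ρ * ‖w‖ + ‖w - z‖ < δ * ‖z‖ := hwz
  linarith
end

section
/- Let X be a separable Banach space (over ℝ or ℂ), T a bounded linear operator on X, and ε ∈ (0,1). Let D₁ be a dense subset of X, and let D₂ = {y_k : k ∈ ℕ} be a countable subset of X (with a fixed enumeration) such that for every x ∈ X \ {0} there are infinitely many k ∈ ℕ with ‖y_k − x‖ ≤ ε‖x‖. Suppose there exist an increasing sequence (n(k))_k of natural numbers and maps S_{n(k)} : D₂ → X such that (1) lim_{k→∞} ‖T^{n(k)} x‖ = 0 for all x ∈ D₁, (2) lim_{k→∞} ‖S_{n(k)} y_k‖ = 0, and (3) lim_{k→∞} ‖T^{n(k)} S_{n(k)} y_k − y_k‖ = 0. Then there exists a vector x̄ ∈ X such that for every z ∈ X, liminf_{k→∞} ‖T^{n(k)} x̄ − z‖ ≤ ε‖z‖. -/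
open Filter Topology

/-- For a sequence of continuous maps, the set of points which some map of index at least `N`
sends within `r` of `z` is open. -/
theorem isOpen_setOf_exists_norm_sub_lt {E F : Type*} [TopologicalSpace E]
    [SeminormedAddCommGroup F] {f : ℕ → E → F} (hf : ∀ k, Continuous (f k)) (z : F) (r : ℝ)
    (N : ℕ) : IsOpen {x | ∃ k ≥ N, ‖f k x - z‖ < r} := by
  have h : {x | ∃ k ≥ N, ‖f k x - z‖ < r} = ⋃ k, ⋃ _ : k ≥ N, {x | ‖f k x - z‖ < r} := by
    ext x
    simp
  rw [h]
  exact isOpen_iUnion fun k => isOpen_iUnion fun _ =>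
    isOpen_lt ((hf k).sub continuous_const).norm continuous_const

/-- Under the hypotheses of the ε-Hypercyclicity Criterion, the points whose orbit comes, after
stage `N`, within `ε * ‖z‖ + δ` of `z` are dense. -/
theorem dense_setOf_exists_norm_sub_lt {𝕜 X : Type*} [NontriviallyNormedField 𝕜]
    [NormedAddCommGroup X] [NormedSpace 𝕜 X] {A : ℕ → X →L[𝕜] X} {ε : ℝ}
    {D : Set X} (hD : Dense D) {y s : ℕ → X}
    (hy : ∀ x : X, x ≠ 0 → {k : ℕ | ‖y k - x‖ ≤ ε * ‖x‖}.Infinite)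
    (h1 : ∀ x ∈ D, Tendsto (fun k => ‖A k x‖) atTop (𝓝 0))
    (h2 : Tendsto (fun k => ‖s k‖) atTop (𝓝 0))
    (h3 : Tendsto (fun k => ‖A k (s k) - y k‖) atTop (𝓝 0))
    (z : X) {δ : ℝ} (hδ : 0 < δ) (N : ℕ) :
    Dense {x | ∃ k ≥ N, ‖A k x - z‖ < ε * ‖z‖ + δ} := by
  rcases eq_or_ne z 0 with rfl | hz
  · refine hD.mono fun x hx => ?_
    obtain ⟨k, hk, hkN⟩ :=
      (((h1 x hx).eventually_lt_const hδ).and (eventually_ge_atTop N)).exists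
    exact ⟨k, hkN, by simpa using hk⟩
  · refine Metric.dense_iff.2 fun u r hr => ?_
    obtain ⟨v, hvr, hv⟩ := Metric.dense_iff.1 hD u (r / 2) (half_pos hr)
    rw [Metric.mem_ball, dist_eq_norm] at hvr
    have hfreq : ∃ᶠ k in atTop, ‖y k - z‖ ≤ ε * ‖z‖ :=
      Nat.frequently_atTop_iff_infinite.2 (hy z hz)
    obtain ⟨k, hyk, hAv, hs, hAs, hkN⟩ := (hfreq.and_eventually
      (((h1 v hv).eventually_lt_const (half_pos hδ)).and
        ((h2.eventually_lt_const (half_pos hr)).and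
          ((h3.eventually_lt_const (half_pos hδ)).and (eventually_ge_atTop N))))).exists
    refine ⟨v + s k, ?_, k, hkN, ?_⟩
    · rw [Metric.mem_ball, dist_eq_norm, show v + s k - u = (v - u) + s k by abel]
      linarith [norm_add_le (v - u) (s k)]
    · rw [map_add, show A k v + A k (s k) - z = A k v + (A k (s k) - y k) + (y k - z) by abel]
      linarith [norm_add₃_le (a := A k v) (b := A k (s k) - y k) (c := y k - z)]

/-- Under the hypotheses of the ε-Hypercyclicity Criterion, there exists a vector `x̄` such
that for every `z`, `liminf_k ‖T^(n k) x̄ - z‖ ≤ ε * ‖z‖`. -/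
theorem epsilon_hypercyclicity_criterion_liminf
    {𝕜 X : Type*} [RCLike 𝕜] [NormedAddCommGroup X] [NormedSpace 𝕜 X]
    [CompleteSpace X] [TopologicalSpace.SeparableSpace X]
    (T : X →L[𝕜] X) {ε : ℝ} (hε : ε ∈ Set.Ioo (0 : ℝ) 1)
    (D₁ : Set X) (hD₁ : Dense D₁)
    (y : ℕ → X)
    (hy : ∀ x : X, x ≠ 0 → {k : ℕ | ‖y k - x‖ ≤ ε * ‖x‖}.Infinite)
    (n : ℕ → ℕ) (hn : StrictMono n)
    (S : ℕ → X → X)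
    (h1 : ∀ x ∈ D₁, Tendsto (fun k => ‖(T ^ n k) x‖) atTop (𝓝 0))
    (h2 : Tendsto (fun k => ‖S k (y k)‖) atTop (𝓝 0))
    (h3 : Tendsto (fun k => ‖(T ^ n k) (S k (y k)) - y k‖) atTop (𝓝 0)) :
    ∃ x : X, ∀ z : X, Filter.liminf (fun k => ‖(T ^ n k) x - z‖) atTop ≤ ε * ‖z‖ := by
  let d := TopologicalSpace.denseSeq X
  have hdense : Dense (⋂ p : ℕ × ℕ × ℕ,
      {x | ∃ k ≥ p.2.2, ‖(T ^ n k) x - d p.1‖ < ε * ‖d p.1‖ + 1 / ((p.2.1 : ℝ) + 1)}) :=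
    dense_iInter_of_isOpen
      (fun p => isOpen_setOf_exists_norm_sub_lt (fun k => (T ^ n k).continuous) _ _ _)
      (fun p => dense_setOf_exists_norm_sub_lt (A := fun k => T ^ n k) hD₁ hy h1 h2 h3 _
        Nat.one_div_pos_of_nat _)
  obtain ⟨x, hx⟩ := hdense.nonempty
  rw [Set.mem_iInter] at hx
  refine ⟨x, fun z => le_of_forall_pos_le_add fun δ hδ => ?_⟩
  refine liminf_le_of_frequently_le (frequently_atTop.2 fun N => ?_)
    (isBoundedUnder_of ⟨0, fun k => norm_nonneg _⟩)
  obtain ⟨_, hball, i, rfl⟩ := Metric.dense_iff.1 (TopologicalSpace.denseRange_denseSeq X) z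
    (δ / 3) (by positivity)
  rw [Metric.mem_ball, dist_eq_norm] at hball
  obtain ⟨m, hm⟩ := exists_nat_one_div_lt (show 0 < δ / 3 by positivity)
  obtain ⟨k, hkN, hk⟩ := hx (i, m, N)
  refine ⟨k, hkN, ?_⟩
  dsimp only [d] at hk
  set w := TopologicalSpace.denseSeq X i
  have hw : ε * ‖w‖ ≤ ε * ‖z‖ + δ / 3 := by
    have : ‖w‖ - ‖z‖ ≤ ‖w - z‖ := norm_sub_norm_le w z
    nlinarith [hε.1, hε.2, norm_nonneg (w - z)]
  have htri := norm_sub_le_norm_sub_add_norm_sub ((T ^ n k) x) w z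
  linarith
end

section
/- Let X be a separable infinite-dimensional Banach space and let T be a bounded linear operator on X that satisfies the Hypercyclicity Criterion. Then for every ε ∈ (0,1), T satisfies the ε-Hypercyclicity Criterion; that is, there exist a dense subset D₁ of X, a countable subset D₂ = {y_k : k ∈ ℕ} of X (with a fixed enumeration) such that for every x ∈ X \ {0} there are infinitely many k ∈ ℕ with ‖y_k − x‖ ≤ ε‖x‖, an increasing sequence (m(k))_k of natural numbers, and maps S_{m(k)} : D₂ → X such that (1) lim_{k→∞} ‖T^{m(k)} x‖ = 0 for all x ∈ D₁, (2) lim_{k→∞} ‖S_{m(k)} y_k‖ = 0, and (3) lim_{k→∞} ‖T^{m(k)} S_{m(k)} y_k − y_k‖ = 0. -/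
open Filter Topology

/-- A dense subset of a separable pseudometric space contains a sequence visiting every
nonempty open set infinitely often. -/
theorem Dense.exists_seq_infinite_visits {X : Type*} [PseudoMetricSpace X]
    [TopologicalSpace.SeparableSpace X] [Nonempty X] {D : Set X} (hD : Dense D) :
    ∃ y : ℕ → X, (∀ k, y k ∈ D) ∧
      ∀ U : Set X, IsOpen U → U.Nonempty → {k : ℕ | y k ∈ U}.Infinite := by
  have := UniformSpace.secondCountable_of_separable X
  have : Nonempty D := hD.nonempty.to_subtype
  refine ⟨fun k => TopologicalSpace.denseSeq D k.unpair.1, fun k => Subtype.coe_prop _, ?_⟩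
  intro U hU hne
  have hdense : DenseRange (fun j => (TopologicalSpace.denseSeq D j : X)) :=
    hD.denseRange_val.comp (TopologicalSpace.denseRange_denseSeq D) continuous_subtype_val
  obtain ⟨j, hj⟩ := hdense.exists_mem_open hU hne
  have hinj : Function.Injective (Nat.pair j) := fun a b h => (Nat.pair_eq_pair.1 h).2
  refine (Set.infinite_range_of_injective hinj).mono ?_
  rintro _ ⟨i, rfl⟩
  simpa using hj

/-- If a bounded operator `T` on a separable infinite-dimensional Banach space satisfies the
Hypercyclicity Criterion, then for every `ε ∈ (0,1)` it satisfies the ε-Hypercyclicity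
Criterion. -/
theorem hypercyclicity_criterion_implies_epsilon_criterion
    {𝕜 X : Type*} [RCLike 𝕜] [NormedAddCommGroup X] [NormedSpace 𝕜 X]
    [CompleteSpace X] [TopologicalSpace.SeparableSpace X]
    (hinf : ¬ FiniteDimensional 𝕜 X)
    (T : X →L[𝕜] X)
    (hT : ∃ n : ℕ → ℕ, StrictMono n ∧ ∃ D₁ D₂ : Set X, Dense D₁ ∧ Dense D₂ ∧
      ∃ S : ℕ → X → X,
        (∀ x ∈ D₁, Tendsto (fun k => (T ^ n k) x) atTop (𝓝 0)) ∧
        (∀ y ∈ D₂, Tendsto (fun k => S k y) atTop (𝓝 0)) ∧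
        (∀ y ∈ D₂, Tendsto (fun k => (T ^ n k) (S k y)) atTop (𝓝 y)))
    {ε : ℝ} (hε : ε ∈ Set.Ioo (0 : ℝ) 1) :
    ∃ D₁ : Set X, Dense D₁ ∧
      ∃ y : ℕ → X,
        (∀ x : X, x ≠ 0 → {k : ℕ | ‖y k - x‖ ≤ ε * ‖x‖}.Infinite) ∧
        ∃ m : ℕ → ℕ, StrictMono m ∧
          ∃ S : ℕ → X → X,
            (∀ x ∈ D₁, Tendsto (fun k => ‖(T ^ m k) x‖) atTop (𝓝 0)) ∧
            Tendsto (fun k => ‖S k (y k)‖) atTop (𝓝 0) ∧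
            Tendsto (fun k => ‖(T ^ m k) (S k (y k)) - y k‖) atTop (𝓝 0) := by
  obtain ⟨n, hn, D₁, D₂, hD₁, hD₂, S, hTD₁, hS, hTS⟩ := hT
  obtain ⟨y, hyD, hy⟩ := hD₂.exists_seq_infinite_visits
  have hsmall : ∀ j : ℕ, ∀ᶠ k in atTop,
      ‖S k (y j)‖ < 1 / ((j : ℝ) + 1) ∧
        ‖(T ^ n k) (S k (y j)) - y j‖ < 1 / ((j : ℝ) + 1) := by
    intro j
    have h₁ := (hS _ (hyD j)).norm
    have h₂ := ((hTS _ (hyD j)).sub_const (y j)).norm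
    rw [norm_zero] at h₁
    rw [sub_self, norm_zero] at h₂
    exact (h₁.eventually_lt_const Nat.one_div_pos_of_nat).and
      (h₂.eventually_lt_const Nat.one_div_pos_of_nat)
  obtain ⟨φ, hφ, hφy⟩ := extraction_forall_of_eventually hsmall
  refine ⟨D₁, hD₁, y, ?_, n ∘ φ, hn.comp hφ, S ∘ φ, ?_, ?_, ?_⟩
  · intro x hx
    have hr : 0 < ε * ‖x‖ := mul_pos hε.1 (norm_pos_iff.2 hx)
    refine (hy _ Metric.isOpen_ball ⟨x, Metric.mem_ball_self hr⟩).mono fun k hk => ?_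
    exact (mem_ball_iff_norm.1 hk).le
  · intro x hx
    simpa using ((hTD₁ x hx).comp hφ.tendsto_atTop).norm
  · exact squeeze_zero (fun _ => norm_nonneg _) (fun k => (hφy k).1.le)
      tendsto_one_div_add_atTop_nhds_zero_nat
  · exact squeeze_zero (fun _ => norm_nonneg _) (fun k => (hφy k).2.le)
      tendsto_one_div_add_atTop_nhds_zero_nat
end

section
/- Let X and Y be separable infinite-dimensional Banach spaces and let ε ∈ (0,1). Let T be a bounded linear operator on X satisfying the Hypercyclicity Criterion with respect to an increasing sequence (n(k))_k of natural numbers, and let S be a bounded linear operator on Y satisfying the ε-Hypercyclicity Criterion with respect to the same sequence (n(k))_k (i.e., there exist a dense set D₁^Y ⊆ Y, a countable set D₂^Y = {z_k : k ∈ ℕ} ⊆ Y such that every nonzero y ∈ Y satisfies ‖z_k − y‖ ≤ ε‖y‖ for infinitely many k, and maps V_{n(k)} : D₂^Y → Y with S^{n(k)} w → 0 for all w ∈ D₁^Y, ‖V_{n(k)} z_k‖ → 0, and ‖S^{n(k)} V_{n(k)} z_k − z_k‖ → 0). Then the operator T ⊕ S on X ⊕ Y, where X ⊕ Y is equipped with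 the norm ‖(a,b)‖ = max{‖a‖_X, ‖b‖_Y}, is δ-hypercyclic for every δ > ε. -/
open Filter Topology

/-- If the bounded operators `R k` tend to `0` pointwise on a dense set and some null sequence `u`
satisfies `‖R k (u k) - w‖ < c'` frequently, where `c' < c`, then the vectors some `R k` of which
lies within `c` of `w` are dense. -/
theorem dense_setOf_exists_norm_sub_lt_s3 {𝕜 E F : Type*} [NontriviallyNormedField 𝕜]
    [NormedAddCommGroup E] [NormedSpace 𝕜 E] [NormedAddCommGroup F] [NormedSpace 𝕜 F]
    {R : ℕ → E →L[𝕜] F} {D : Set E} (hD : Dense D)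
    (hR : ∀ x ∈ D, Tendsto (fun k => R k x) atTop (𝓝 0))
    {u : ℕ → E} (hu : Tendsto u atTop (𝓝 0)) {w : F} {c' c : ℝ} (hc : c' < c)
    (hw : ∃ᶠ k in atTop, ‖R k (u k) - w‖ < c') :
    Dense {x | ∃ k, ‖R k x - w‖ < c} := by
  refine dense_iff_inter_open.2 fun O hO hne => ?_
  obtain ⟨x, hxO, hxD⟩ := hD.inter_open_nonempty O hO hne
  have hsum : Tendsto (fun k => x + u k) atTop (𝓝 x) := by
    simpa using tendsto_const_nhds.add hu
  have hsmall : ∀ᶠ k in atTop, ‖R k x‖ < c - c' :=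
    (hR x hxD).norm.eventually_lt_const (by simpa using hc)
  obtain ⟨k, hk, hkO, hkx⟩ :=
    (hw.and_eventually ((hsum.eventually (hO.mem_nhds hxO)).and hsmall)).exists
  refine ⟨x + u k, hkO, k, ?_⟩
  calc ‖R k (x + u k) - w‖ = ‖R k x + (R k (u k) - w)‖ := by rw [map_add, add_sub_assoc]
    _ ≤ ‖R k x‖ + ‖R k (u k) - w‖ := norm_add_le _ _
    _ < c := by linarith

/-- For every countable family of targets, if approximating each of them up to a prescribed error
is a dense condition, then one vector approximates all of them. -/
theorem exists_forall_exists_norm_sub_lt {𝕜 E F ι : Type*} [NontriviallyNormedField 𝕜]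
    [NormedAddCommGroup E] [NormedSpace 𝕜 E] [CompleteSpace E]
    [NormedAddCommGroup F] [NormedSpace 𝕜 F] [Countable ι]
    {R : ℕ → E →L[𝕜] F} {w : ι → F} {c : ι → ℝ}
    (h : ∀ i, Dense {x | ∃ k, ‖R k x - w i‖ < c i}) :
    ∃ x, ∀ i, ∃ k, ‖R k x - w i‖ < c i := by
  have hopen (i : ι) : IsOpen {x | ∃ k, ‖R k x - w i‖ < c i} := by
    simp only [Set.ofPred_exists]
    exact isOpen_iUnion fun k => isOpen_lt (by fun_prop) continuous_const
  obtain ⟨x, hx⟩ := (dense_iInter_of_isOpen hopen h).nonempty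
  exact ⟨x, fun i => Set.mem_iInter.1 hx i⟩

theorem ContinuousLinearMap.prodMap_pow {𝕜 X Y : Type*} [Semiring 𝕜]
    [TopologicalSpace X] [AddCommMonoid X] [Module 𝕜 X]
    [TopologicalSpace Y] [AddCommMonoid Y] [Module 𝕜 Y]
    (T : X →L[𝕜] X) (S : Y →L[𝕜] Y) (m : ℕ) :
    T.prodMap S ^ m = (T ^ m).prodMap (S ^ m) := by
  induction m with
  | zero => rfl
  | succ m ih => rw [pow_succ, ih, pow_succ, pow_succ]; rfl

/-- If `T` satisfies the Hypercyclicity Criterion and `S` satisfies the ε-Hypercyclicity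
Criterion with respect to the same increasing sequence of integers, then `T ⊕ S` is
`δ`-hypercyclic on `X ⊕ Y` (with the max norm) for every `δ > ε`. -/
theorem prod_hypercyclic_epsHypercyclic
    {𝕜 X Y : Type*} [RCLike 𝕜]
    [NormedAddCommGroup X] [NormedSpace 𝕜 X] [CompleteSpace X]
    [TopologicalSpace.SeparableSpace X] (hX : ¬ FiniteDimensional 𝕜 X)
    [NormedAddCommGroup Y] [NormedSpace 𝕜 Y] [CompleteSpace Y]
    [TopologicalSpace.SeparableSpace Y] (hY : ¬ FiniteDimensional 𝕜 Y)
    {ε : ℝ} (hε : ε ∈ Set.Ioo (0 : ℝ) 1)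
    (T : X →L[𝕜] X) (S : Y →L[𝕜] Y)
    (n : ℕ → ℕ) (hn : StrictMono n)
    -- `T` satisfies the Hypercyclicity Criterion with respect to `n`
    (DX₁ DX₂ : Set X) (hDX₁ : Dense DX₁) (hDX₂ : Dense DX₂)
    (U : ℕ → X → X)
    (hT1 : ∀ x ∈ DX₁, Tendsto (fun k => (T ^ n k) x) atTop (𝓝 0))
    (hT2 : ∀ x ∈ DX₂, Tendsto (fun k => U k x) atTop (𝓝 0))
    (hT3 : ∀ x ∈ DX₂, Tendsto (fun k => (T ^ n k) (U k x)) atTop (𝓝 x))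
    -- `S` satisfies the ε-Hypercyclicity Criterion with respect to `n`
    (DY₁ : Set Y) (hDY₁ : Dense DY₁)
    (z : ℕ → Y)
    (hz : ∀ y : Y, y ≠ 0 → {k : ℕ | ‖z k - y‖ ≤ ε * ‖y‖}.Infinite)
    (V : ℕ → Y → Y)
    (hS1 : ∀ w ∈ DY₁, Tendsto (fun k => (S ^ n k) w) atTop (𝓝 0))
    (hS2 : Tendsto (fun k => ‖V k (z k)‖) atTop (𝓝 0))
    (hS3 : Tendsto (fun k => ‖(S ^ n k) (V k (z k)) - z k‖) atTop (𝓝 0)) :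
    ∀ δ : ℝ, ε < δ →
      ∃ xy : X × Y, ∀ w : X × Y, w ≠ 0 →
        ∃ m : ℕ, ‖((T.prodMap S) ^ m) xy - w‖ ≤ δ * ‖w‖ := by
  intro δ hδ
  obtain ⟨ρ, hερ, hρδ⟩ := exists_between hδ
  have hε0 : 0 < ε := hε.1
  have hρ0 : 0 < ρ := hε0.trans hερ
  let R : ℕ → X × Y →L[𝕜] X × Y := fun k => (T.prodMap S) ^ n k
  have hR (k : ℕ) (p : X × Y) : R k p = ((T ^ n k) p.1, (S ^ n k) p.2) := by
    simp only [R, ContinuousLinearMap.prodMap_pow]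
    rfl
  have hR0 : ∀ p ∈ DX₁ ×ˢ DY₁, Tendsto (fun k => R k p) atTop (𝓝 0) := by
    rintro p ⟨h1, h2⟩
    simp only [hR]
    exact (hT1 _ h1).prodMk_nhds (hS1 _ h2)
  have hdense (w : X × Y) (hw : w.2 ≠ 0) : Dense {p | ∃ k, ‖R k p - w‖ < ρ * ‖w‖} := by
    have hb : 0 < ‖w.2‖ := norm_pos_iff.2 hw
    have hlt : ε * ‖w.2‖ < ρ * ‖w‖ :=
      (mul_lt_mul_of_pos_right hερ hb).trans_le (by gcongr; exact norm_snd_le w)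
    obtain ⟨c, hc, hcρ⟩ := exists_between hlt
    have hc0 : 0 < c := (mul_pos hε0 hb).trans hc
    obtain ⟨a, ha, haw⟩ := hDX₂.exists_dist_lt w.1 hc0
    rw [dist_comm, dist_eq_norm] at haw
    have hu : Tendsto (fun k => (U k a, V k (z k))) atTop (𝓝 0) :=
      (hT2 a ha).prodMk_nhds (tendsto_zero_iff_norm_tendsto_zero.2 hS2)
    refine dense_setOf_exists_norm_sub_lt_s3 (hDX₁.prod hDY₁) hR0 hu hcρ ?_
    have hfst : ∀ᶠ k in atTop, ‖(T ^ n k) (U k a) - w.1‖ < c :=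
      ((hT3 a ha).sub_const w.1).norm.eventually_lt_const haw
    have hsnd : ∀ᶠ k in atTop, ‖(S ^ n k) (V k (z k)) - z k‖ < c - ε * ‖w.2‖ :=
      hS3.eventually_lt_const (sub_pos.2 hc)
    refine ((Nat.frequently_atTop_iff_infinite.2 (hz w.2 hw)).and_eventually
      (hfst.and hsnd)).mono ?_
    rintro k ⟨hzk, h1, h2⟩
    rw [hR, Prod.norm_def]
    refine max_lt h1 ?_
    have := norm_sub_le_norm_sub_add_norm_sub ((S ^ n k) (V k (z k))) (z k) w.2
    exact this.trans_lt (by linarith)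
  let d := TopologicalSpace.denseSeq (X × Y)
  obtain ⟨x, hx⟩ := exists_forall_exists_norm_sub_lt
    (w := fun i : {i : ℕ // (d i).2 ≠ 0} => d i) fun i => hdense (d i) i.2
  refine ⟨x, fun w hw => ?_⟩
  have hw0 : 0 < ‖w‖ := norm_pos_iff.2 hw
  have hY' : Nontrivial Y := by
    by_contra h
    rw [not_nontrivial_iff_subsingleton] at h
    exact hY inferInstance
  have : (𝓝[≠] (0 : Y)).NeBot := Module.punctured_nhds_neBot 𝕜 Y 0
  have hY0 : Dense {p : X × Y | p.2 ≠ 0} :=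
    (dense_compl_singleton (0 : Y)).preimage isOpenMap_snd
  have hO : IsOpen {p : X × Y | p.2 ≠ 0} := isOpen_ne.preimage continuous_snd
  set η : ℝ := (δ - ρ) * ‖w‖ / (1 + ρ) with hη
  have hη0 : 0 < η := by have := sub_pos.2 hρδ; positivity
  obtain ⟨p, ⟨hpη, hp0⟩, i, rfl⟩ :=
    (TopologicalSpace.denseRange_denseSeq (X × Y)).inter_open_nonempty
    _ (Metric.isOpen_ball.inter hO)
    (hY0.inter_open_nonempty _ Metric.isOpen_ball ⟨w, Metric.mem_ball_self hη0⟩)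
  obtain ⟨k, hk⟩ := hx ⟨i, hp0⟩
  refine ⟨n k, ?_⟩
  have hdw : ‖d i - w‖ < η := by rw [← dist_eq_norm]; exact hpη
  have hdn : ‖d i‖ ≤ ‖w‖ + ‖d i - w‖ := norm_le_norm_add_norm_sub' _ _
  have hηeq : η * (1 + ρ) = (δ - ρ) * ‖w‖ := by rw [hη]; field_simp
  calc ‖R k x - w‖ ≤ ‖R k x - d i‖ + ‖d i - w‖ := norm_sub_le_norm_sub_add_norm_sub _ _ _
    _ ≤ ρ * (‖w‖ + η) + η := by
      refine add_le_add (hk.le.trans ?_) hdw.le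
      gcongr
      exact hdn.trans (by gcongr)
    _ = δ * ‖w‖ := by linarith
end

section
/- Let X be a separable Banach space that contains a complemented closed subspace isomorphic to c₀(ℕ) or to ℓ^p(ℕ) for some p ∈ [1,∞). Then for every ε ∈ (0,1), X admits a bounded linear operator that is ε-hypercyclic but not hypercyclic. -/
open Filter Topology ENNReal

/-- A normalized sequence with biorthogonal functionals that is total and on which all diagonal
contractions composed with injective reindexings act as contractions, as for the unit vector bases
of `c₀` and `ℓᵖ`. -/
structure SymmetricBasis (𝕜 Z : Type*) [RCLike 𝕜] [NormedAddCommGroup Z] [NormedSpace 𝕜 Z] where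
  vec : ℕ → Z
  coord : ℕ → Z →L[𝕜] 𝕜
  norm_vec_le : ∀ i, ‖vec i‖ ≤ 1
  norm_coord_le : ∀ i, ‖coord i‖ ≤ 1
  coord_vec : ∀ i j, coord i (vec j) = if i = j then 1 else 0
  eq_zero_of_coord : ∀ z, (∀ i, coord i z = 0) → z = 0
  dense_span : Dense (Submodule.span 𝕜 (Set.range vec) : Set Z)
  exists_weightedShift : ∀ σ : ℕ → ℕ, σ.Injective → ∀ a : ℕ → 𝕜, (∀ i, ‖a i‖ ≤ 1) →
    ∃ B : Z →L[𝕜] Z, ‖B‖ ≤ 1 ∧ ∀ i z, coord i (B z) = a i * coord (σ i) z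

section SymmetricBasis

variable {𝕜 : Type*} [RCLike 𝕜]

/-- The unit vector basis of `ℓᵖ`. -/
noncomputable def lpSymmetricBasis (p : ℝ≥0∞) [hp : Fact (1 ≤ p)] (hpt : p ≠ ⊤) :
    SymmetricBasis 𝕜 (lp (fun _ : ℕ => 𝕜) p) where
  vec i := lp.single p i (1 : 𝕜)
  coord i := lp.evalCLM 𝕜 (fun _ : ℕ => 𝕜) p i
  norm_vec_le i := by
    rw [lp.norm_single (zero_lt_one.trans_le hp.out)]; simp
  norm_coord_le i := by
    refine ContinuousLinearMap.opNorm_le_bound _ zero_le_one fun z => ?_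
    rw [one_mul]
    exact lp.norm_apply_le_norm (zero_lt_one.trans_le hp.out).ne' z i
  coord_vec i j := by
    change (lp.single p j (1 : 𝕜) : ℕ → 𝕜) i = _
    split_ifs with h
    · subst h; simp
    · exact lp.single_apply_ne p j _ h
  eq_zero_of_coord z hz := lp.ext (funext hz)
  dense_span := by
    intro z
    refine mem_closure_of_tendsto (lp.hasSum_single hpt z) (Eventually.of_forall fun s => ?_)
    refine Submodule.sum_mem _ fun i _ => ?_
    have h := Submodule.smul_mem _ (z i : 𝕜) (Submodule.subset_span (R := 𝕜)
      (Set.mem_range_self (f := fun i => (lp.single p i (1 : 𝕜) : lp (fun _ : ℕ => 𝕜) p)) i))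
    rw [← lp.single_smul, smul_eq_mul, mul_one] at h
    exact h
  exists_weightedShift σ hσ a ha := by
    have hp0 : 0 < p.toReal := ENNReal.toReal_pos (zero_lt_one.trans_le hp.out).ne' hpt
    have hle (z : lp (fun _ : ℕ => 𝕜) p) (i : ℕ) :
        ‖a i * z (σ i)‖ ^ p.toReal ≤ ‖z (σ i)‖ ^ p.toReal := by
      refine Real.rpow_le_rpow (norm_nonneg _) ?_ hp0.le
      rw [norm_mul]
      exact mul_le_of_le_one_left (norm_nonneg _) (ha i)
    have hs (z : lp (fun _ : ℕ => 𝕜) p) : Summable fun i => ‖z (σ i)‖ ^ p.toReal :=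
      ((lp.hasSum_norm hp0 z).summable).comp_injective hσ
    have hs' (z : lp (fun _ : ℕ => 𝕜) p) : Summable fun i => ‖a i * z (σ i)‖ ^ p.toReal :=
      Summable.of_nonneg_of_le (fun i => by positivity) (hle z) (hs z)
    let L : lp (fun _ : ℕ => 𝕜) p →ₗ[𝕜] lp (fun _ : ℕ => 𝕜) p :=
      { toFun := fun z => ⟨fun i => a i * z (σ i), memℓp_gen (hs' z)⟩
        map_add' := fun y z => lp.ext (funext fun i => mul_add (a i) (y (σ i)) (z (σ i)))
        map_smul' := fun c z => lp.ext (funext fun i => mul_left_comm (a i) c (z (σ i))) }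
    refine ⟨L.mkContinuous 1 fun z => ?_, L.mkContinuous_norm_le zero_le_one _, fun i z => rfl⟩
    rw [one_mul]
    refine lp.norm_le_of_tsum_le hp0 (norm_nonneg _) ?_
    rw [lp.norm_rpow_eq_tsum hp0 z]
    exact ((hs' z).tsum_le_tsum (hle z) (hs z)).trans
      (tsum_comp_le_tsum_of_inj (lp.hasSum_norm hp0 z).summable (fun i => by positivity) hσ)

/-- The `i`-th unit vector of `c₀`. -/
noncomputable def c0Vec (i : ℕ) : ZeroAtInftyContinuousMap ℕ 𝕜 :=
  ⟨⟨Pi.single i 1, continuous_of_discreteTopology⟩, by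
    rw [cocompact_eq_cofinite, Nat.cofinite_eq_atTop]
    refine tendsto_const_nhds.congr' ?_
    filter_upwards [eventually_gt_atTop i] with j hj
    simp [hj.ne']⟩

/-- The `i`-th coordinate functional of `c₀`. -/
noncomputable def c0Coord (i : ℕ) : ZeroAtInftyContinuousMap ℕ 𝕜 →L[𝕜] 𝕜 :=
  LinearMap.mkContinuous
    { toFun := fun z => z i
      map_add' := fun _ _ => rfl
      map_smul' := fun _ _ => rfl } 1 fun z => by
        rw [one_mul]; exact z.toBCF.norm_coe_le_norm i

theorem c0Coord_c0Vec (i j : ℕ) : c0Coord i (c0Vec (𝕜 := 𝕜) j) = if i = j then 1 else 0 := by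
  change (Pi.single j 1 : ℕ → 𝕜) i = _
  rw [Pi.single_apply]

/-- The unit vector basis of `c₀`. -/
noncomputable def c0SymmetricBasis :
    SymmetricBasis 𝕜 (ZeroAtInftyContinuousMap ℕ 𝕜) where
  vec := c0Vec
  coord := c0Coord
  norm_vec_le i := by
    refine (BoundedContinuousFunction.norm_le zero_le_one).2 fun j => ?_
    change ‖(Pi.single i 1 : ℕ → 𝕜) j‖ ≤ 1
    by_cases h : j = i
    · subst h; simp
    · simp [h]
  norm_coord_le i := LinearMap.mkContinuous_norm_le _ zero_le_one _
  coord_vec := c0Coord_c0Vec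
  eq_zero_of_coord z hz := ZeroAtInftyContinuousMap.ext hz
  dense_span := by
    intro z
    rw [Metric.mem_closure_iff]
    intro δ hδ
    have hz : ∀ᶠ i in atTop, ‖z i‖ < δ / 2 := by
      have := z.zero_at_infty'
      rw [cocompact_eq_cofinite, Nat.cofinite_eq_atTop] at this
      exact (this.norm.eventually_lt_const (by simpa using half_pos hδ))
    obtain ⟨n, hn⟩ := eventually_atTop.1 hz
    have hw (j : ℕ) : c0Coord j (∑ i ∈ Finset.range n, z i • c0Vec (𝕜 := 𝕜) i) =
        if j < n then z j else 0 := by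
      simp [c0Coord_c0Vec]
    refine ⟨∑ i ∈ Finset.range n, z i • c0Vec i, Submodule.sum_mem _ fun i _ =>
      Submodule.smul_mem _ _ (Submodule.subset_span ⟨i, rfl⟩), ?_⟩
    rw [dist_eq_norm]
    refine lt_of_le_of_lt ((BoundedContinuousFunction.norm_le (half_pos hδ).le).2 fun j => ?_)
      (half_lt_self hδ)
    change ‖c0Coord j (z - ∑ i ∈ Finset.range n, z i • c0Vec i)‖ ≤ δ / 2
    rw [map_sub, hw]
    split_ifs with h
    · change ‖z j - z j‖ ≤ _
      simpa using (half_pos hδ).le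
    · rw [sub_zero]
      exact (hn j (not_lt.1 h)).le
  exists_weightedShift σ hσ a ha := by
    have hle (z : ZeroAtInftyContinuousMap ℕ 𝕜) (i : ℕ) : ‖a i * z (σ i)‖ ≤ ‖z (σ i)‖ := by
      rw [norm_mul]
      exact mul_le_of_le_one_left (norm_nonneg _) (ha i)
    let L : ZeroAtInftyContinuousMap ℕ 𝕜 →ₗ[𝕜] ZeroAtInftyContinuousMap ℕ 𝕜 :=
      { toFun := fun z => ⟨⟨fun i => a i * z (σ i), continuous_of_discreteTopology⟩, by
          refine squeeze_zero_norm (hle z) ?_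
          have := z.zero_at_infty'
          rw [cocompact_eq_cofinite, Nat.cofinite_eq_atTop] at this ⊢
          simpa using (this.comp hσ.nat_tendsto_atTop).norm⟩
        map_add' := fun y z =>
          ZeroAtInftyContinuousMap.ext fun i => mul_add (a i) (y (σ i)) (z (σ i))
        map_smul' := fun c z =>
          ZeroAtInftyContinuousMap.ext fun i => mul_left_comm (a i) c (z (σ i)) }
    refine ⟨L.mkContinuous 1 fun z => ?_, L.mkContinuous_norm_le zero_le_one _, fun i z => rfl⟩
    rw [one_mul]
    exact (BoundedContinuousFunction.norm_le (norm_nonneg _)).2 fun i =>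
      (hle z i).trans (z.toBCF.norm_coe_le_norm (σ i))

end SymmetricBasis

/-- A biorthogonal system in `X`, indexed by two families of countably many chains together with one
extra vector, such that `X` is generated by it together with the common kernel of the chain
functionals, and such that all weighted backward shifts along the chains are uniformly bounded. -/
structure ChainSystem (𝕜 X : Type*) [RCLike 𝕜] [NormedAddCommGroup X] [NormedSpace 𝕜 X] where
  vec : Bool × ℕ × ℕ → X
  coord : Bool × ℕ × ℕ → X →L[𝕜] 𝕜
  vec₀ : X
  coord₀ : X →L[𝕜] 𝕜
  coordBound : ℝ
  shiftBound : ℝ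
  norm_vec_le : ∀ i, ‖vec i‖ ≤ 1
  norm_coord_le : ∀ i, ‖coord i‖ ≤ coordBound
  shiftBound_nonneg : 0 ≤ shiftBound
  coord_vec : ∀ i j, coord i (vec j) = if i = j then 1 else 0
  coord_vec₀ : ∀ i, coord i vec₀ = 0
  coord₀_vec : ∀ i, coord₀ (vec i) = 0
  coord₀_vec₀ : coord₀ vec₀ = 1
  dense_kernel_sup_span : Dense
    (((⨅ i, (coord i).ker) ⊔ Submodule.span 𝕜 (Set.range vec) : Submodule 𝕜 X) : Set X)
  exists_weightedShift : ∀ a : Bool × ℕ × ℕ → 𝕜, (∀ i, ‖a i‖ ≤ 1) →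
    ∃ B : X →L[𝕜] X, ‖B‖ ≤ shiftBound ∧
      (∀ b l j, B (vec (b, l, j + 1)) = a (b, l, j) • vec (b, l, j)) ∧
      (∀ b l, B (vec (b, l, 0)) = 0) ∧ ∀ y, (∀ i, coord i y = 0) → B y = 0

section

variable {𝕜 X : Type*} [RCLike 𝕜] [NormedAddCommGroup X] [NormedSpace 𝕜 X]

/-- A symmetric basis of a complemented subspace yields a chain system. -/
theorem SymmetricBasis.nonempty_chainSystem {Z : Type*} [NormedAddCommGroup Z] [NormedSpace 𝕜 Z]
    (S : SymmetricBasis 𝕜 Z) (ι : Z →L[𝕜] X) (π : X →L[𝕜] Z) (hπ : ∀ z, π (ι z) = z) :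
    Nonempty (ChainSystem 𝕜 X) := by
  let E : Option (Bool × ℕ × ℕ) ≃ ℕ := Classical.choice nonempty_equiv_of_countable
  have hc : (0 : ℝ) < ‖ι‖ + 1 := by positivity
  let c : 𝕜 := ((‖ι‖ + 1 : ℝ) : 𝕜)
  have hc0 : c ≠ 0 := RCLike.ofReal_ne_zero.2 hc.ne'
  have hcn : ‖c‖ = ‖ι‖ + 1 := by
    simp only [c, RCLike.norm_ofReal]; exact abs_of_pos hc
  let v : Option (Bool × ℕ × ℕ) → X := fun i => c⁻¹ • ι (S.vec (E i))
  let f : Option (Bool × ℕ × ℕ) → X →L[𝕜] 𝕜 := fun i => c • (S.coord (E i)).comp π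
  have hfv (i j) : f i (v j) = if i = j then 1 else 0 := by
    simp [f, v, hπ, S.coord_vec, hc0]
  have hfι (i z) : f i (ι z) = c * S.coord (E i) z := by simp [f, hπ]
  let σ : Option (Bool × ℕ × ℕ) → Option (Bool × ℕ × ℕ) :=
    Option.map fun i => (i.1, i.2.1, i.2.2 + 1)
  have hσ : σ.Injective := Option.map_injective fun i j h => by
    simpa [Prod.ext_iff] using h
  refine ⟨{
    vec := fun i => v (some i)
    coord := fun i => f (some i)
    vec₀ := v none
    coord₀ := f none
    coordBound := (‖ι‖ + 1) * ‖π‖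
    shiftBound := ‖ι‖ * ‖π‖
    norm_vec_le := fun i => ?_
    norm_coord_le := fun i => ?_
    shiftBound_nonneg := by positivity
    coord_vec := fun i j => by simp [hfv]
    coord_vec₀ := fun i => by simp [hfv]
    coord₀_vec := fun i => by simp [hfv]
    coord₀_vec₀ := by simp [hfv]
    dense_kernel_sup_span := ?_
    exists_weightedShift := fun a ha => ?_ }⟩
  · rw [norm_smul, norm_inv, hcn, inv_mul_le_iff₀ hc, mul_one]
    exact (ι.le_opNorm_of_le (S.norm_vec_le _)).trans (by linarith)
  · rw [norm_smul, hcn]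
    refine mul_le_mul_of_nonneg_left ?_ hc.le
    refine (ContinuousLinearMap.opNorm_comp_le _ _).trans ?_
    exact mul_le_of_le_one_left (norm_nonneg _) (S.norm_coord_le _)
  · set W : Submodule 𝕜 X := (⨅ i, (f (some i)).ker) ⊔
      Submodule.span 𝕜 (Set.range fun i => v (some i)) with hW
    have hv (i) : v i ∈ W := by
      cases i with
      | none =>
        refine Submodule.mem_sup_left ?_
        simp [hfv]
      | some i => exact Submodule.mem_sup_right (Submodule.subset_span ⟨i, rfl⟩)
    have hι (z) : ι z ∈ W.topologicalClosure := by
      have hsub : Submodule.span 𝕜 (Set.range S.vec) ≤ W.comap (ι : Z →ₗ[𝕜] X) := by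
        rw [Submodule.span_le]
        rintro _ ⟨n, rfl⟩
        have := W.smul_mem c (hv (E.symm n))
        simpa [v, smul_smul, hc0] using this
      have := map_mem_closure ι.continuous (S.dense_span z) (t := W) fun y hy => hsub hy
      exact this
    intro x
    have hx : x - ι (π x) ∈ W := by
      refine Submodule.mem_sup_left ?_
      simp [f, hπ]
    have := W.topologicalClosure.add_mem (W.le_topologicalClosure hx) (hι (π x))
    rw [sub_add_cancel] at this
    exact this
  · obtain ⟨B, hB, hBc⟩ := S.exists_weightedShift (E ∘ σ ∘ E.symm)
      (E.injective.comp (hσ.comp E.symm.injective)) (fun n => (E.symm n).elim 0 a) fun n => by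
        cases E.symm n with
        | none => simp
        | some i => exact ha i
    have hBc' (i z) : S.coord (E i) (B z) = i.elim 0 a * S.coord (E (σ i)) z := by
      simp [hBc]
    refine ⟨ι.comp (B.comp π), ?_, fun b l j => ?_, fun b l => ?_, fun y hy => ?_⟩
    · refine (ContinuousLinearMap.opNorm_comp_le _ _).trans ?_
      refine mul_le_mul_of_nonneg_left ?_ (norm_nonneg _)
      exact (ContinuousLinearMap.opNorm_comp_le _ _).trans
        (mul_le_of_le_one_left (norm_nonneg _) hB)
    · have h : B (S.vec (E (some (b, l, j + 1)))) = a (b, l, j) • S.vec (E (some (b, l, j))) := by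
        rw [← sub_eq_zero]
        refine S.eq_zero_of_coord _ fun n => ?_
        obtain ⟨i, rfl⟩ := E.surjective n
        rw [map_sub, hBc', map_smul, S.coord_vec, S.coord_vec]
        cases i with
        | none => simp
        | some i =>
          obtain ⟨b', l', j'⟩ := i
          by_cases hi : (b', l', j') = (b, l, j)
          · simp only [Prod.mk.injEq] at hi
            obtain ⟨rfl, rfl, rfl⟩ := hi
            simp [σ]
          · have : ¬ (b', l', j' + 1) = (b, l, j + 1) := by simpa using hi
            simp only [Prod.mk.injEq] at this hi
            simp [σ, hi]
      simp only [v, ContinuousLinearMap.comp_apply, map_smul, hπ, h]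
      rw [smul_comm]
    · have h : B (S.vec (E (some (b, l, 0)))) = 0 := by
        refine S.eq_zero_of_coord _ fun n => ?_
        obtain ⟨i, rfl⟩ := E.surjective n
        rw [hBc', S.coord_vec]
        cases i <;> simp [σ]
      simp only [v, ContinuousLinearMap.comp_apply, map_smul, hπ, h, map_zero, smul_zero]
    · have h : B (π y) = 0 := by
        refine S.eq_zero_of_coord _ fun n => ?_
        obtain ⟨i, rfl⟩ := E.surjective n
        rw [hBc']
        cases i with
        | none => simp
        | some i =>
          have := hy (i.1, i.2.1, i.2.2 + 1)
          simp only [f, smul_apply, ContinuousLinearMap.comp_apply,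
            smul_eq_mul, mul_eq_zero, hc0, false_or] at this
          simp [σ, this]
      simp [h]

/-- A nuclear operator given by a geometrically small sequence of rank one operators. -/
theorem exists_hasSum_smulRight [CompleteSpace X] (g : ℕ → X →L[𝕜] 𝕜) (v : ℕ → X)
    (h : ∀ l, ‖g l‖ * ‖v l‖ ≤ (1 / 2 : ℝ) ^ (l + 1)) :
    ∃ N : X →L[𝕜] X, ‖N‖ ≤ 1 ∧ ∀ x, HasSum (fun l => g l x • v l) (N x) := by
  have hgeo : HasSum (fun l : ℕ => (1 / 2 : ℝ) ^ (l + 1)) 1 := by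
    simpa [pow_succ] using hasSum_geometric_two.mul_right (1 / 2 : ℝ)
  have hn (l : ℕ) : ‖(g l).smulRight (v l)‖ ≤ (1 / 2 : ℝ) ^ (l + 1) := by
    rw [ContinuousLinearMap.norm_smulRight_apply]; exact h l
  have hs : Summable fun l => (g l).smulRight (v l) :=
    Summable.of_norm_bounded hgeo.summable hn
  refine ⟨∑' l, (g l).smulRight (v l), tsum_of_norm_bounded hgeo hn, fun x => ?_⟩
  simpa using hs.hasSum.mapL (ContinuousLinearMap.apply 𝕜 X x)

namespace ChainSystem

variable (S : ChainSystem 𝕜 X)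

/-- The common kernel of all chain functionals. -/
def kernel : Submodule 𝕜 X := ⨅ i, (S.coord i).ker

theorem mem_kernel {y : X} : y ∈ S.kernel ↔ ∀ i, S.coord i y = 0 := by
  simp [kernel]

/-- The kernel together with the chains of level below `n`. -/
def low (n : ℕ) : Submodule 𝕜 X := S.kernel ⊔ Submodule.span 𝕜 (S.vec '' {i | i.2.1 < n})

variable {S}

theorem kernel_le_low (n : ℕ) : S.kernel ≤ S.low n := le_sup_left

theorem vec_mem_low {b : Bool} {l j n : ℕ} (h : l < n) : S.vec (b, l, j) ∈ S.low n :=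
  Submodule.mem_sup_right (Submodule.subset_span ⟨_, h, rfl⟩)

theorem low_le {n : ℕ} {p : Submodule 𝕜 X} (hK : ∀ y ∈ S.kernel, y ∈ p)
    (hv : ∀ b l j, l < n → S.vec (b, l, j) ∈ p) : S.low n ≤ p := by
  refine sup_le hK (Submodule.span_le.2 ?_)
  rintro _ ⟨⟨b, l, j⟩, hi, rfl⟩
  exact hv b l j hi

theorem low_mono {m n : ℕ} (h : m ≤ n) : S.low m ≤ S.low n :=
  low_le (fun _ hy => kernel_le_low n hy) fun _ _ _ hl => vec_mem_low (hl.trans_le h)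

theorem coord_of_mem_low {n : ℕ} {y : X} (hy : y ∈ S.low n) {b : Bool} {l j : ℕ} (h : n ≤ l) :
    S.coord (b, l, j) y = 0 := by
  refine low_le (p := (S.coord (b, l, j)).ker) (fun y hy => S.mem_kernel.1 hy _)
    (fun b' l' j' hl' => ?_) hy
  have : l ≠ l' := by omega
  simp [S.coord_vec, this]

theorem dense_iUnion_low : Dense (⋃ n, (S.low n : Set X)) := by
  refine S.dense_kernel_sup_span.mono ?_
  have hd : Directed (· ≤ ·) S.low := (monotone_nat_of_le_succ fun n =>
    low_mono n.le_succ).directed_le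
  rw [← Submodule.coe_iSup_of_directed _ hd]
  refine sup_le ((kernel_le_low 0).trans (le_iSup S.low 0)) (Submodule.span_le.2 ?_)
  rintro _ ⟨⟨b, l, j⟩, rfl⟩
  exact (le_iSup S.low (l + 1)) (vec_mem_low l.lt_succ_self)

theorem hom_ext {E : Type*} [NormedAddCommGroup E] [NormedSpace 𝕜 E] {A B : X →L[𝕜] E}
    (hK : ∀ y ∈ S.kernel, A y = B y) (hv : ∀ b l j, A (S.vec (b, l, j)) = B (S.vec (b, l, j))) :
    A = B := by
  refine DFunLike.coe_injective
    (Continuous.ext_on S.dense_kernel_sup_span A.continuous B.continuous ?_)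
  have : S.kernel ⊔ Submodule.span 𝕜 (Set.range S.vec) ≤
      LinearMap.eqLocus (A : X →ₗ[𝕜] E) (B : X →ₗ[𝕜] E) := by
    refine sup_le hK (Submodule.span_le.2 ?_)
    rintro _ ⟨⟨b, l, j⟩, rfl⟩
    exact hv b l j
  exact this

variable (S) in
/-- Functionals that vanish on the kernel and decay geometrically along the chains are uniformly
bounded. -/
theorem exists_forall_norm_apply_le : ∃ C : ℝ, ∀ A : X →L[𝕜] 𝕜, (∀ y ∈ S.kernel, A y = 0) →
    (∀ b l j, ‖A (S.vec (b, l, j))‖ ≤ (1 / 2 : ℝ) ^ l * (1 / 2 : ℝ) ^ j) →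
    ∀ x, ‖A x‖ ≤ C * ‖x‖ := by
  let W : Bool × ℕ × ℕ → ℝ := fun i => 1 * ((1 / 2 : ℝ) ^ i.2.1 * (1 / 2 : ℝ) ^ i.2.2)
  have hW : Summable W := by
    refine Summable.mul_of_nonneg (f := fun _ : Bool => (1 : ℝ))
      (g := fun i : ℕ × ℕ => (1 / 2 : ℝ) ^ i.1 * (1 / 2 : ℝ) ^ i.2) (hasSum_fintype _).summable
      (summable_geometric_two.mul_of_nonneg summable_geometric_two ?_ ?_) ?_ ?_
    all_goals intro _; simp only [Pi.zero_apply]; positivity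
  refine ⟨(∑' i, W i) * S.coordBound, fun A hA hAv x => ?_⟩
  have hn (i) : ‖A (S.vec i) • S.coord i‖ ≤ W i * S.coordBound := by
    rw [norm_smul]
    refine mul_le_mul ?_ (S.norm_coord_le i) (norm_nonneg _) (by positivity)
    simpa only [W, one_mul] using hAv i.1 i.2.1 i.2.2
  have hs : Summable fun i => A (S.vec i) • S.coord i :=
    Summable.of_norm_bounded (hW.mul_right _) hn
  have hev (y) : HasSum (fun i => A (S.vec i) * S.coord i y)
      ((∑' i, A (S.vec i) • S.coord i) y) := by
    simpa using hs.hasSum.mapL (ContinuousLinearMap.apply 𝕜 𝕜 y)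
  have hAeq : A = ∑' i, A (S.vec i) • S.coord i := by
    refine hom_ext (S := S) (fun y hy => ?_) fun b l j => ?_
    · rw [hA y hy]
      have := hev y
      simp only [S.mem_kernel.1 hy, mul_zero] at this
      exact hasSum_zero.unique this
    · have h := hasSum_single (f := fun i => A (S.vec i) * S.coord i (S.vec (b, l, j)))
        (b, l, j) fun i hi => by simp [S.coord_vec, hi]
      rw [(hev _).unique h]
      simp [S.coord_vec]
  rw [hAeq]
  refine (ContinuousLinearMap.le_opNorm _ _).trans ?_
  gcongr
  exact tsum_of_norm_bounded (hW.hasSum.mul_right _) hn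

variable (S) in
/-- Weighted backward shifts whose values at the bottom of the second family of chains are
prescribed. -/
theorem exists_shift_add_nuclear [CompleteSpace X] {R : ℝ} (hR : 0 < R)
    (a : Bool × ℕ × ℕ → 𝕜) (ha : ∀ i, ‖a i‖ ≤ R) (v : ℕ → X)
    (hv : ∀ l, S.coordBound * ‖v l‖ ≤ (1 / 2 : ℝ) ^ (l + 1)) :
    ∃ T : X →L[𝕜] X, ‖T‖ ≤ R * S.shiftBound + 1 ∧ (∀ y ∈ S.kernel, T y = 0) ∧
      (∀ b l j, T (S.vec (b, l, j + 1)) = a (b, l, j) • S.vec (b, l, j)) ∧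
      (∀ l, T (S.vec (false, l, 0)) = 0) ∧ ∀ l, T (S.vec (true, l, 0)) = v l := by
  have hR0 : (R : 𝕜) ≠ 0 := RCLike.ofReal_ne_zero.2 hR.ne'
  have hRn : ‖(R : 𝕜)‖ = R := by rw [RCLike.norm_ofReal, abs_of_pos hR]
  obtain ⟨B, hB, hBs, hB0, hBK⟩ := S.exists_weightedShift (fun i => a i / R) fun i => by
    rw [norm_div, hRn]
    exact div_le_one_of_le₀ (ha i) hR.le
  obtain ⟨N, hN, hNs⟩ := exists_hasSum_smulRight (fun l => S.coord (true, l, 0)) v fun l =>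
    (mul_le_mul_of_nonneg_right (S.norm_coord_le _) (norm_nonneg _)).trans (hv l)
  have hN0 {x : X} (hx : ∀ l, S.coord (true, l, 0) x = 0) : N x = 0 := by
    refine (hNs x).unique ?_
    simpa only [hx, zero_smul] using hasSum_zero
  refine ⟨(R : 𝕜) • B + N, ?_, fun y hy => ?_, fun b l j => ?_, fun l => ?_, fun l => ?_⟩
  · refine (norm_add_le _ _).trans (add_le_add ?_ hN)
    rw [norm_smul, hRn]
    gcongr
  · simp [hBK y (S.mem_kernel.1 hy), hN0 fun l => S.mem_kernel.1 hy _]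
  · rw [add_apply, smul_apply, hBs, smul_smul, mul_div_cancel₀ _ hR0, hN0, add_zero]
    simp [S.coord_vec]
  · rw [add_apply, smul_apply, hB0, hN0, add_zero, smul_zero]
    simp [S.coord_vec]
  · rw [add_apply, smul_apply, hB0, smul_zero, zero_add]
    have h := hasSum_single (f := fun i => S.coord (true, i, 0) (S.vec (true, l, 0)) • v i)
      l fun i hi => by simp [S.coord_vec, hi]
    rw [(hNs _).unique h]
    simp [S.coord_vec]

end ChainSystem

theorem ContinuousLinearMap.norm_pow_apply_le {T : X →L[𝕜] X} {τ : ℝ} (hT : ‖T‖ ≤ τ) (m : ℕ)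
    (x : X) : ‖(T ^ m) x‖ ≤ τ ^ m * ‖x‖ := by
  induction m generalizing x with
  | zero => simp
  | succ m ih =>
    rw [pow_succ, mul_apply_eq_comp, pow_succ, mul_assoc]
    refine (ih _).trans ?_
    have := (norm_nonneg T).trans hT
    gcongr
    exact T.le_of_opNorm_le hT x

namespace ChainSystem

/-- The action on a chain system of the operator to be constructed. The chain `(true, l, ·)` of
length `N l` feeds into `u l` perturbed by `κ • w l`, where `w l` copies the values of `coord₀`
along the orbit of `u l` to the chain `(false, l, ·)` of length `M l`. -/
structure IsModel (S : ChainSystem 𝕜 X) (M N : ℕ → ℕ) (η : ℕ → ℝ) (ρ κ : ℝ) (u w : ℕ → X)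
    (T : X →L[𝕜] X) : Prop where
  one_le : ∀ l, 1 ≤ M l
  step_le : ∀ l, N l + 1 + M l ≤ M (l + 1)
  mem_low : ∀ l, u l ∈ S.low l
  map_kernel : ∀ y ∈ S.kernel, T y = 0
  map_false_zero : ∀ l, T (S.vec (false, l, 0)) = 0
  map_false_succ : ∀ l j, T (S.vec (false, l, j + 1)) =
    if j + 1 < M l then (ρ : 𝕜) • S.vec (false, l, j) else 0
  map_true_zero : ∀ l, T (S.vec (true, l, 0)) = (η l : 𝕜) • (u l + (κ : 𝕜) • w l)
  map_true_succ : ∀ l j, T (S.vec (true, l, j + 1)) =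
    if j + 1 ≤ N l then (2 : 𝕜) • S.vec (true, l, j) else 0
  copy_eq : ∀ l, w l = ∑ m ∈ Finset.range (M l),
    (((ρ : 𝕜) ^ m)⁻¹ * S.coord₀ ((T ^ m) (u l))) • S.vec (false, l, m)

variable (S : ChainSystem 𝕜 X)

theorem norm_sum_inv_pow_smul_le {T : X →L[𝕜] X} {τ : ℝ} (hτ : 0 < τ) (hT : ‖T‖ ≤ τ) (u : X)
    (l M : ℕ) :
    ‖∑ m ∈ Finset.range M, ((((2 * τ : ℝ) : 𝕜) ^ m)⁻¹ * S.coord₀ ((T ^ m) u)) •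
      S.vec (false, l, m)‖ ≤ 2 * ‖S.coord₀‖ * ‖u‖ := by
  have hterm (m : ℕ) : ‖((((2 * τ : ℝ) : 𝕜) ^ m)⁻¹ * S.coord₀ ((T ^ m) u)) •
      S.vec (false, l, m)‖ ≤ (1 / 2 : ℝ) ^ m * (‖S.coord₀‖ * ‖u‖) := by
    have hTm : ‖S.coord₀ ((T ^ m) u)‖ ≤ ‖S.coord₀‖ * (τ ^ m * ‖u‖) :=
      S.coord₀.le_opNorm_of_le (ContinuousLinearMap.norm_pow_apply_le hT m u)
    rw [norm_smul, norm_mul, norm_inv, norm_pow, RCLike.norm_ofReal, abs_of_pos (by positivity)]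
    calc ((2 * τ) ^ m)⁻¹ * ‖S.coord₀ ((T ^ m) u)‖ * ‖S.vec (false, l, m)‖
        ≤ ((2 * τ) ^ m)⁻¹ * (‖S.coord₀‖ * (τ ^ m * ‖u‖)) * 1 := by
          gcongr
          exact S.norm_vec_le _
      _ = _ := by
          rw [mul_pow, div_pow, one_pow]
          field_simp
  refine (norm_sum_le_of_le _ fun m _ => hterm m).trans ?_
  rw [← Finset.sum_mul, mul_assoc]
  gcongr
  have := summable_geometric_two.sum_le_tsum (Finset.range M) fun i _ => by positivity
  rwa [tsum_geometric_two] at this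

theorem exists_isModel [CompleteSpace X] (M N : ℕ → ℕ) (η : ℕ → ℝ) (κ ε : ℝ) (u : ℕ → X)
    (hM : ∀ l, 1 ≤ M l) (hMN : ∀ l, N l + 1 + M l ≤ M (l + 1)) (hlow : ∀ l, u l ∈ S.low l)
    (hη : ∀ l, 0 ≤ η l) (hu : ∀ l, S.coordBound * (η l * (2 * ‖u l‖)) ≤ (1 / 2 : ℝ) ^ (l + 1))
    (hκ : 0 ≤ κ) (hκε : κ * (2 * ‖S.coord₀‖) ≤ ε / 2) (hε : ε ≤ 1) :
    ∃ (T : X →L[𝕜] X) (w : ℕ → X),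
      S.IsModel M N η (2 * (2 * S.shiftBound + 1)) κ u w T ∧
      ‖T‖ ≤ 2 * (2 * S.shiftBound + 1) * S.shiftBound + 1 ∧
      ∀ l, ‖(κ : 𝕜) • w l‖ ≤ ε / 2 * ‖u l‖ := by
  have hK := S.shiftBound_nonneg
  have hKf : 0 ≤ S.coordBound := (norm_nonneg _).trans (S.norm_coord_le (true, 0, 0))
  have hηn (l : ℕ) : ‖((η l : ℝ) : 𝕜)‖ = η l := by rw [RCLike.norm_ofReal, abs_of_nonneg (hη l)]
  obtain ⟨T₀, hT₀n, hT₀K, hT₀s, hT₀q, hT₀r⟩ := S.exists_shift_add_nuclear two_pos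
    (fun i => if i.1 = true ∧ i.2.2 + 1 ≤ N i.2.1 then (2 : 𝕜) else 0)
    (fun i => by split_ifs <;> simp) (fun l => (η l : 𝕜) • u l) fun l => by
      refine le_trans ?_ (hu l)
      rw [norm_smul, hηn]
      have := hη l
      gcongr
      linarith [norm_nonneg (u l)]
  set τ : ℝ := 2 * S.shiftBound + 1 with hτ
  have hτ0 : 0 < τ := by positivity
  let w : ℕ → X := fun l => ∑ m ∈ Finset.range (M l),
    ((((2 * τ : ℝ) : 𝕜) ^ m)⁻¹ * S.coord₀ ((T₀ ^ m) (u l))) • S.vec (false, l, m)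
  have hw (l : ℕ) : ‖(κ : 𝕜) • w l‖ ≤ ε / 2 * ‖u l‖ := by
    rw [norm_smul, RCLike.norm_ofReal, abs_of_nonneg hκ]
    calc κ * ‖w l‖ ≤ κ * (2 * ‖S.coord₀‖ * ‖u l‖) := by
          gcongr
          exact S.norm_sum_inv_pow_smul_le hτ0 hT₀n (u l) l (M l)
      _ = κ * (2 * ‖S.coord₀‖) * ‖u l‖ := by ring
      _ ≤ _ := by gcongr
  obtain ⟨T, hTn, hTK, hTs, hTq, hTr⟩ := S.exists_shift_add_nuclear (R := 2 * τ) (by positivity)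
    (fun i => if i.1 = true then if i.2.2 + 1 ≤ N i.2.1 then (2 : 𝕜) else 0
      else if i.2.2 + 1 < M i.2.1 then ((2 * τ : ℝ) : 𝕜) else 0)
    (fun i => by
      split_ifs
      · simp only [RCLike.norm_ofNat]; linarith
      · simpa using hτ0.le
      · rw [RCLike.norm_ofReal, abs_of_pos (by positivity)]
      · simpa using hτ0.le)
    (fun l => (η l : 𝕜) • (u l + (κ : 𝕜) • w l)) fun l => by
      refine le_trans ?_ (hu l)
      rw [norm_smul, hηn]
      have := hη l
      gcongr
      refine (norm_add_le _ _).trans ?_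
      have := hw l
      nlinarith [norm_nonneg (u l)]
  have hf₀w (l : ℕ) : S.coord₀ (w l) = 0 := by simp [w, S.coord₀_vec]
  have hT₀false (l j : ℕ) : T₀ (S.vec (false, l, j)) = 0 := by
    cases j with
    | zero => exact hT₀q l
    | succ j => simp [hT₀s]
  have hT₀w (l : ℕ) : T₀ (w l) = 0 := by simp [w, hT₀false]
  have hf₀ : S.coord₀.comp T = S.coord₀.comp T₀ := by
    refine hom_ext (S := S) (fun y hy => by simp [hTK y hy, hT₀K y hy]) fun b l j => ?_
    cases b <;> cases j <;>
      simp [hTs, hTq, hTr, hT₀s, hT₀r, hT₀false, hf₀w, S.coord₀_vec, apply_ite S.coord₀]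
  have hcomp : T₀.comp T = T₀.comp T₀ := by
    refine hom_ext (S := S) (fun y hy => by simp [hTK y hy, hT₀K y hy]) fun b l j => ?_
    cases b <;> cases j <;> 
      simp [hTs, hTq, hTr, hT₀s, hT₀r, hT₀false, hT₀w, apply_ite T₀]
  have hpow (m : ℕ) (x : X) : S.coord₀ ((T ^ m) x) = S.coord₀ ((T₀ ^ m) x) := by
    induction m generalizing x with
    | zero => rfl
    | succ m ih =>
      rw [pow_succ, pow_succ, mul_apply_eq_comp, mul_apply_eq_comp, ih]
      cases m with
      | zero => exact DFunLike.congr_fun hf₀ x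
      | succ m =>
        rw [pow_succ, mul_apply_eq_comp, mul_apply_eq_comp]
        exact congrArg (fun y => S.coord₀ ((T₀ ^ m) y)) (DFunLike.congr_fun hcomp x)
  exact ⟨T, w, ⟨hM, hMN, hlow, hTK, hTq, fun l j => by simp [hTs], hTr, fun l j => by simp [hTs],
    fun l => by simp only [w, hpow]⟩, hTn, hw⟩

end ChainSystem

theorem ContinuousLinearMap.pow_apply_eq_zero_of_le {T : X →L[𝕜] X} {m n : ℕ} {x : X}
    (hx : (T ^ m) x = 0) (h : m ≤ n) : (T ^ n) x = 0 := by
  obtain ⟨k, rfl⟩ := Nat.exists_eq_add_of_le' h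
  rw [pow_add, mul_apply_eq_comp, hx, map_zero]

namespace ChainSystem

namespace IsModel

variable {S : ChainSystem 𝕜 X} {M N : ℕ → ℕ} {η : ℕ → ℝ} {ρ κ : ℝ} {u w : ℕ → X} {T : X →L[𝕜] X}

theorem monotone (h : S.IsModel M N η ρ κ u w T) : Monotone M :=
  monotone_nat_of_le_succ fun l => by have := h.step_le l; omega

theorem pow_false_add (h : S.IsModel M N η ρ κ u w T) (l m j : ℕ) (hm : m + j < M l) :
    (T ^ m) (S.vec (false, l, m + j)) = (ρ : 𝕜) ^ m • S.vec (false, l, j) := by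
  induction m with
  | zero => simp
  | succ m ih =>
    rw [pow_succ, mul_apply_eq_comp, Nat.succ_add, h.map_false_succ, if_pos (by omega), map_smul,
      ih (by omega), smul_smul, pow_succ']

theorem pow_false_of_lt (h : S.IsModel M N η ρ κ u w T) (l : ℕ) {m j : ℕ} (hm : j < m) :
    (T ^ m) (S.vec (false, l, j)) = 0 := by
  obtain ⟨m, rfl⟩ : ∃ k, m = k + 1 := ⟨m - 1, by omega⟩
  rw [pow_succ, mul_apply_eq_comp]
  induction j generalizing m with
  | zero => rw [h.map_false_zero, map_zero]
  | succ j ih =>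
    obtain ⟨m, rfl⟩ : ∃ k, m = k + 1 := ⟨m - 1, by omega⟩
    rw [h.map_false_succ]
    split_ifs
    · rw [map_smul, pow_succ, mul_apply_eq_comp, ih m (by omega), smul_zero]
    · rw [map_zero]

theorem pow_false_eq_zero (h : S.IsModel M N η ρ κ u w T) (l j : ℕ) :
    (T ^ M l) (S.vec (false, l, j)) = 0 := by
  rcases lt_or_ge j (M l) with hj | hj
  · exact h.pow_false_of_lt l hj
  · have := h.one_le l
    refine ContinuousLinearMap.pow_apply_eq_zero_of_le (m := 1) ?_ this
    obtain ⟨j, rfl⟩ : ∃ k, j = k + 1 := ⟨j - 1, by omega⟩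
    rw [pow_one, h.map_false_succ, if_neg (by omega)]

theorem apply_pow_false_eq_zero (h : S.IsModel M N η ρ κ u w T) {A : X →L[𝕜] 𝕜} {l : ℕ}
    (hA : ∀ j, A (S.vec (false, l, j)) = 0) (m j : ℕ) : A ((T ^ m) (S.vec (false, l, j))) = 0 := by
  induction m generalizing j with
  | zero => exact hA j
  | succ m ih =>
    rw [pow_succ, mul_apply_eq_comp]
    cases j with
    | zero => rw [h.map_false_zero, map_zero, map_zero]
    | succ j =>
      rw [h.map_false_succ]
      split_ifs
      · rw [map_smul, map_smul, ih, smul_zero]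
      · rw [map_zero, map_zero]

theorem apply_pow_copy_eq_zero (h : S.IsModel M N η ρ κ u w T) {A : X →L[𝕜] 𝕜} {l : ℕ}
    (hA : ∀ j, A (S.vec (false, l, j)) = 0) (m : ℕ) : A ((T ^ m) (w l)) = 0 := by
  rw [h.copy_eq, map_sum, map_sum]
  refine Finset.sum_eq_zero fun k _ => ?_
  rw [map_smul, map_smul, h.apply_pow_false_eq_zero hA, smul_zero]

theorem pow_true_add (h : S.IsModel M N η ρ κ u w T) (l m j : ℕ) (hm : m + j ≤ N l) :
    (T ^ m) (S.vec (true, l, m + j)) = (2 : 𝕜) ^ m • S.vec (true, l, j) := by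
  induction m with
  | zero => simp
  | succ m ih =>
    rw [pow_succ, mul_apply_eq_comp, Nat.succ_add, h.map_true_succ, if_pos (by omega), map_smul,
      ih (by omega), smul_smul, pow_succ']

theorem pow_true_add_succ (h : S.IsModel M N η ρ κ u w T) {l j : ℕ} (hj : j ≤ N l) (m : ℕ) :
    (T ^ (m + (j + 1))) (S.vec (true, l, j)) =
      ((2 : 𝕜) ^ j * (η l : 𝕜)) • (T ^ m) (u l + (κ : 𝕜) • w l) := by
  rw [pow_add, mul_apply_eq_comp, pow_succ', mul_apply_eq_comp]
  have := h.pow_true_add l j 0 hj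
  rw [add_zero] at this
  rw [this, map_smul, h.map_true_zero, smul_smul, map_smul]

theorem pow_true_of_lt (h : S.IsModel M N η ρ κ u w T) {l j m : ℕ} (hj : N l < j) (hm : 1 ≤ m) :
    (T ^ m) (S.vec (true, l, j)) = 0 := by
  refine ContinuousLinearMap.pow_apply_eq_zero_of_le (m := 1) ?_ hm
  obtain ⟨j, rfl⟩ : ∃ k, j = k + 1 := ⟨j - 1, by omega⟩
  rw [pow_one, h.map_true_succ, if_neg (by omega)]

theorem pow_eq_zero_of_mem_low (h : S.IsModel M N η ρ κ u w T) {l : ℕ} {y : X} (hy : y ∈ S.low l) :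
    (T ^ M l) y = 0 := by
  suffices H : ∀ l, S.low l ≤ ((T ^ M l : X →L[𝕜] X)).ker from H l hy
  clear hy y l
  intro l
  induction l using Nat.strong_induction_on with
  | _ l ih =>
    refine low_le (fun y hy => ?_) fun b l' j hl => ?_
    · exact ContinuousLinearMap.pow_apply_eq_zero_of_le (m := 1)
        (by rw [pow_one, h.map_kernel y hy]) (h.one_le l)
    · change (T ^ M l) (S.vec (b, l', j)) = 0
      have hM := h.monotone hl
      have hs := h.step_le l'
      simp only [Nat.succ_eq_add_one] at hM
      cases b with
      | false =>
        exact ContinuousLinearMap.pow_apply_eq_zero_of_le (h.pow_false_eq_zero l' j) (by omega)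
      | true =>
        rcases le_or_gt j (N l') with hj | hj
        · refine ContinuousLinearMap.pow_apply_eq_zero_of_le (m := M l' + (j + 1)) ?_ (by omega)
          have hu : (T ^ M l') (u l') = 0 := ih l' hl (h.mem_low l')
          rw [h.pow_true_add_succ hj, map_add, map_smul, hu, h.copy_eq]
          simp [h.pow_false_eq_zero]
        · exact h.pow_true_of_lt hj (h.one_le l)

theorem map_mem_low (h : S.IsModel M N η ρ κ u w T) {l : ℕ} {y : X} (hy : y ∈ S.low l) :
    T y ∈ S.low l := by
  refine low_le (p := (S.low l).comap (T : X →ₗ[𝕜] X)) (fun y hy => ?_) (fun b l' j hl => ?_) hy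
  · simp [h.map_kernel y hy]
  · change T (S.vec (b, l', j)) ∈ S.low l
    have hv (b j) := vec_mem_low (S := S) (b := b) (j := j) hl
    cases b <;> cases j
    · simp [h.map_false_zero]
    · rw [h.map_false_succ]
      split_ifs
      · exact Submodule.smul_mem _ _ (hv _ _)
      · exact Submodule.zero_mem _
    · rw [h.map_true_zero, h.copy_eq]
      exact Submodule.smul_mem _ _ (Submodule.add_mem _ (low_mono hl.le (h.mem_low l'))
        (Submodule.smul_mem _ _ (Submodule.sum_mem _ fun _ _ => Submodule.smul_mem _ _ (hv _ _))))
    · rw [h.map_true_succ]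
      split_ifs
      · exact Submodule.smul_mem _ _ (hv _ _)
      · exact Submodule.zero_mem _

theorem pow_mem_low (h : S.IsModel M N η ρ κ u w T) {l : ℕ} {y : X} (hy : y ∈ S.low l) (m : ℕ) :
    (T ^ m) y ∈ S.low l := by
  induction m generalizing y with
  | zero => exact hy
  | succ m ih =>
    rw [pow_succ, mul_apply_eq_comp]
    exact ih (h.map_mem_low hy)

theorem coord_pow_copy (h : S.IsModel M N η ρ κ u w T) (hρ : ρ ≠ 0) (l m : ℕ) :
    S.coord (false, l, 0) ((T ^ m) (w l)) = S.coord₀ ((T ^ m) (u l)) := by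
  have hρ' : (ρ : 𝕜) ≠ 0 := RCLike.ofReal_ne_zero.2 hρ
  have hc (k : ℕ) (hk : k < M l) : S.coord (false, l, 0) ((T ^ m) (S.vec (false, l, k))) =
      if k = m then (ρ : 𝕜) ^ m else 0 := by
    rcases lt_or_ge k m with hkm | hkm
    · rw [h.pow_false_of_lt l hkm, if_neg hkm.ne, map_zero]
    · obtain ⟨j, rfl⟩ := Nat.exists_eq_add_of_le hkm
      rw [h.pow_false_add l m j hk, map_smul, S.coord_vec]
      cases j <;> simp
  rw [h.copy_eq, map_sum, map_sum, Finset.sum_congr rfl fun k hk => by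
    rw [map_smul, map_smul, hc k (Finset.mem_range.1 hk), smul_ite, smul_zero]]
  rw [Finset.sum_ite_eq']
  split_ifs with hm
  · rw [smul_eq_mul]
    field_simp
  · rw [Finset.mem_range, not_lt] at hm
    rw [ContinuousLinearMap.pow_apply_eq_zero_of_le (h.pow_eq_zero_of_mem_low (h.mem_low l)) hm,
      map_zero]

end IsModel

end ChainSystem

/-- An operator has no dense orbit if its powers are uniformly bounded when tested against suitable
uniformly bounded functionals, one for each power, which are normalized at a fixed vector. -/
theorem not_dense_orbit_of_functionals {T : X →L[𝕜] X} {e : X} {G C : ℝ}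
    (h : ∀ n, ∃ φ : X →L[𝕜] 𝕜, φ e = 1 ∧ ‖φ‖ ≤ G ∧ ∀ x, ‖φ ((T ^ n) x)‖ ≤ C * ‖x‖) (x : X) :
    ¬ Dense (Set.range fun n : ℕ => (T ^ n) x) := by
  classical
  intro hd
  obtain ⟨φ₀, hφ₀, hG, -⟩ := h 0
  have hG0 : 0 ≤ G := (norm_nonneg _).trans hG
  have he : e ≠ 0 := by rintro rfl; simp at hφ₀
  have : Nontrivial X := ⟨e, 0, he⟩
  have (y : X) : NeBot (𝓝[≠] y) := Module.punctured_nhds_neBot 𝕜 X y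
  have hC : 0 < 2 * (|C| + 1) := by positivity
  have hG' : 0 < 2 * (G + 1) := by positivity
  obtain ⟨_, ⟨m, rfl⟩, hm⟩ := hd.exists_dist_lt 0 (inv_pos.2 hC)
  obtain ⟨y, ⟨⟨n, rfl⟩, hn⟩, hny⟩ :=
    (hd.sdiff_finset ((Finset.range m).image fun n => (T ^ n) x)).exists_dist_lt e (inv_pos.2 hG')
  dsimp only at hm hn hny
  have hmn : m ≤ n := by
    by_contra hlt
    exact hn (Finset.mem_coe.2 (Finset.mem_image_of_mem _ (Finset.mem_range.2 (not_le.1 hlt))))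
  obtain ⟨k, rfl⟩ := Nat.exists_eq_add_of_le' hmn
  rw [dist_zero_left] at hm
  rw [dist_eq_norm] at hny
  obtain ⟨φ, hφ, hφG, hφT⟩ := h k
  have h1 : ‖φ ((T ^ (k + m)) x)‖ < 1 / 2 := by
    rw [pow_add, mul_apply_eq_comp]
    calc _ ≤ C * ‖(T ^ m) x‖ := hφT _
      _ ≤ (|C| + 1) * ‖(T ^ m) x‖ := by gcongr; linarith [le_abs_self C]
      _ < (|C| + 1) * (2 * (|C| + 1))⁻¹ := by gcongr
      _ = 1 / 2 := by field_simp
  have h2 : ‖φ (e - (T ^ (k + m)) x)‖ ≤ 1 / 2 := by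
    calc _ ≤ G * ‖e - (T ^ (k + m)) x‖ := φ.le_of_opNorm_le hφG _
      _ ≤ (G + 1) * (2 * (G + 1))⁻¹ := by gcongr; linarith
      _ = 1 / 2 := by field_simp
  have h3 : (1 : 𝕜) = φ ((T ^ (k + m)) x) + φ (e - (T ^ (k + m)) x) := by
    rw [← map_add, add_sub_cancel, hφ]
  have h4 := congrArg norm h3
  rw [norm_one] at h4
  linarith [norm_add_le (φ ((T ^ (k + m)) x)) (φ (e - (T ^ (k + m)) x))]

namespace ChainSystem.IsModel

variable {S : ChainSystem 𝕜 X} {M N : ℕ → ℕ} {η : ℕ → ℝ} {ρ κ : ℝ} {u w : ℕ → X} {T : X →L[𝕜] X}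

/-- For `M l ≤ n < M (l + 1)`, the functional `coord₀ - κ⁻¹ • coord (false, l, 0)`
composed with `T ^ n` decays geometrically along the chains. -/
theorem exists_functional (h : S.IsModel M N η ρ κ u w T) (hρ : ρ ≠ 0) (hκ : 0 < κ) {τ G : ℝ}
    (hτ : 1 ≤ τ) (hT : ‖T‖ ≤ τ) (hG : ‖S.coord₀‖ + κ⁻¹ * S.coordBound ≤ G) (hη : ∀ l, 0 ≤ η l)
    (hsmall : ∀ l, η l * (4 * τ) ^ M l * ‖u l‖ * G ≤ (1 / 2 : ℝ) ^ (l + 1)) {l n : ℕ}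
    (hln : M l ≤ n) (hnl : n < M (l + 1)) :
    ∃ φ : X →L[𝕜] 𝕜, φ S.vec₀ = 1 ∧ ‖φ‖ ≤ G ∧ (∀ y ∈ S.kernel, φ ((T ^ n) y) = 0) ∧
      ∀ b l' j, ‖φ ((T ^ n) (S.vec (b, l', j)))‖ ≤ (1 / 2 : ℝ) ^ l' * (1 / 2 : ℝ) ^ j := by
  have hκ' : (κ : 𝕜) ≠ 0 := RCLike.ofReal_ne_zero.2 hκ.ne'
  have hn : 1 ≤ n := (h.one_le l).trans hln
  set φ : X →L[𝕜] 𝕜 := S.coord₀ - (κ : 𝕜)⁻¹ • S.coord (false, l, 0) with hφ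
  have hφG : ‖φ‖ ≤ G := by
    refine (norm_sub_le _ _).trans (le_trans ?_ hG)
    rw [norm_smul, norm_inv, RCLike.norm_ofReal, abs_of_pos hκ]
    gcongr
    exact S.norm_coord_le _
  have hG0 : 0 ≤ G := (norm_nonneg _).trans hφG
  have hφtrue (l' j) : φ (S.vec (true, l', j)) = 0 := by simp [hφ, S.coord₀_vec, S.coord_vec]
  have hφfalse {l' : ℕ} (hl' : l ≠ l') (j) : φ (S.vec (false, l', j)) = 0 := by
    simp [hφ, S.coord₀_vec, S.coord_vec, hl']
  have hφu (m : ℕ) : φ ((T ^ m) (u l + (κ : 𝕜) • w l)) = 0 := by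
    have h1 := coord_of_mem_low (h.pow_mem_low (h.mem_low l) m) (b := false) (j := 0) le_rfl
    have h2 := h.apply_pow_copy_eq_zero (l := l) (fun j => S.coord₀_vec (false, l, j)) m
    rw [map_add, map_smul, hφ, sub_apply, smul_apply, map_add, map_add, map_smul, map_smul, h1, h2,
      h.coord_pow_copy hρ, smul_zero, add_zero, zero_add, smul_smul, inv_mul_cancel₀ hκ', one_smul,
      sub_self]
  refine ⟨φ, by simp [hφ, S.coord₀_vec₀, S.coord_vec₀], hφG, fun y hy => ?_, fun b l' j => ?_⟩
  · rw [ContinuousLinearMap.pow_apply_eq_zero_of_le (m := 1)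
      (by rw [pow_one, h.map_kernel y hy]) hn,
      map_zero]
  have hpos : (0 : ℝ) ≤ (1 / 2 : ℝ) ^ l' * (1 / 2 : ℝ) ^ j := by positivity
  suffices H : φ ((T ^ n) (S.vec (b, l', j))) = 0 ∨
      ‖φ ((T ^ n) (S.vec (b, l', j)))‖ ≤ (1 / 2 : ℝ) ^ l' * (1 / 2 : ℝ) ^ j by
    rcases H with H | H
    · rwa [H, norm_zero]
    · exact H
  rcases lt_or_ge l' l with hl | hl
  · left
    rw [ContinuousLinearMap.pow_apply_eq_zero_of_le (h.pow_eq_zero_of_mem_low (vec_mem_low hl)) hln,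
      map_zero]
  cases b with
  | false =>
    left
    rcases hl.eq_or_lt with rfl | hl
    · rw [ContinuousLinearMap.pow_apply_eq_zero_of_le (h.pow_false_eq_zero l j) hln, map_zero]
    · exact h.apply_pow_false_eq_zero (hφfalse hl.ne) n j
  | true =>
    rcases lt_or_ge (N l') j with hj | hj
    · left
      rw [h.pow_true_of_lt hj hn, map_zero]
    rcases le_or_gt n j with hnj | hnj
    · left
      obtain ⟨i, rfl⟩ := Nat.exists_eq_add_of_le hnj
      rw [h.pow_true_add l' n i hj, map_smul, hφtrue, smul_zero]
    obtain ⟨m, rfl⟩ := Nat.exists_eq_add_of_le' hnj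
    rw [Nat.succ_eq_add_one, h.pow_true_add_succ hj, map_smul]
    rcases hl.eq_or_lt with rfl | hl
    · left
      rw [hφu, smul_zero]
    · right
      have hM : M (l + 1) ≤ M l' := h.monotone hl
      have hη' := hη l'
      rw [map_add, map_smul, map_add, map_smul, h.apply_pow_copy_eq_zero (hφfalse hl.ne), smul_zero,
        add_zero, norm_smul, norm_mul, norm_pow, RCLike.norm_ofNat, RCLike.norm_ofReal,
        abs_of_nonneg hη']
      have hφT : ‖φ ((T ^ m) (u l'))‖ ≤ G * (τ ^ M l' * ‖u l'‖) := by
        refine φ.le_of_opNorm_le_of_le hφG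
          ((ContinuousLinearMap.norm_pow_apply_le hT m _).trans ?_)
        gcongr
        omega
      have h4 : (2 : ℝ) ^ j * 2 ^ j ≤ 4 ^ M l' := by
        rw [← mul_pow]
        norm_num
        exact pow_le_pow_right₀ (by norm_num) (by omega)
      have h2 : (1 / 2 : ℝ) ^ j * 2 ^ j = 1 := by
        rw [← mul_pow]; norm_num
      calc 2 ^ j * η l' * ‖φ ((T ^ m) (u l'))‖
          ≤ 2 ^ j * η l' * (G * (τ ^ M l' * ‖u l'‖)) := by gcongr
        _ = (1 / 2 : ℝ) ^ j * (2 ^ j * 2 ^ j) * η l' * (G * (τ ^ M l' * ‖u l'‖)) := by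
          rw [← mul_assoc ((1 / 2 : ℝ) ^ j), h2, one_mul]
        _ ≤ (1 / 2 : ℝ) ^ j * 4 ^ M l' * η l' * (G * (τ ^ M l' * ‖u l'‖)) := by gcongr
        _ = (1 / 2 : ℝ) ^ j * (η l' * (4 * τ) ^ M l' * ‖u l'‖ * G) := by
          rw [mul_pow]; ring
        _ ≤ (1 / 2 : ℝ) ^ j * (1 / 2 : ℝ) ^ (l' + 1) := by gcongr; exact hsmall l'
        _ ≤ (1 / 2 : ℝ) ^ l' * (1 / 2 : ℝ) ^ j := by
          rw [mul_comm]
          gcongr ?_ * _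
          exact pow_le_pow_of_le_one (by norm_num) (by norm_num) l'.le_succ

theorem not_dense_orbit (h : S.IsModel M N η ρ κ u w T) (hM : M 0 = 1) (hρ : ρ ≠ 0) (hκ : 0 < κ)
    {τ G : ℝ} (hτ : 1 ≤ τ) (hT : ‖T‖ ≤ τ) (hG : ‖S.coord₀‖ + κ⁻¹ * S.coordBound ≤ G)
    (hη : ∀ l, 0 ≤ η l)
    (hsmall : ∀ l, η l * (4 * τ) ^ M l * ‖u l‖ * G ≤ (1 / 2 : ℝ) ^ (l + 1)) (x : X) :
    ¬ Dense (Set.range fun n : ℕ => (T ^ n) x) := by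
  obtain ⟨C, hC⟩ := S.exists_forall_norm_apply_le
  have hKf : 0 ≤ S.coordBound := (norm_nonneg _).trans (S.norm_coord_le (true, 0, 0))
  have hκKf : 0 ≤ κ⁻¹ * S.coordBound := by positivity
  refine not_dense_orbit_of_functionals (e := S.vec₀) (G := G) (C := max C ‖S.coord₀‖)
    (fun n => ?_) x
  rcases Nat.eq_zero_or_pos n with rfl | hn
  · refine ⟨S.coord₀, S.coord₀_vec₀, by linarith, fun x => ?_⟩
    exact (S.coord₀.le_opNorm x).trans (by gcongr; exact le_max_right _ _)
  have hMs : StrictMono M := strictMono_nat_of_lt_succ fun l => by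
    have := h.step_le l; omega
  obtain ⟨l, hl, hl'⟩ : ∃ l, M l ≤ n ∧ n < M (l + 1) := by
    have hex : ∃ l, n < M l := ⟨n + 1, hMs.le_apply⟩
    have hspec := Nat.find_spec hex
    obtain ⟨l, hl⟩ : ∃ l, Nat.find hex = l + 1 :=
      Nat.exists_eq_succ_of_ne_zero fun h0 => by rw [h0] at hspec; omega
    exact ⟨l, not_lt.1 (Nat.find_min hex (by omega)), hl ▸ hspec⟩
  obtain ⟨φ, hφ, hφG, hφK, hφv⟩ := h.exists_functional hρ hκ hτ hT hG hη hsmall hl hl'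
  refine ⟨φ, hφ, hφG, fun x => (hC (φ.comp (T ^ n)) hφK hφv x).trans ?_⟩
  gcongr
  exact le_max_left _ _

theorem norm_pow_smul_top_le (h : S.IsModel M N η ρ κ u w T) (hη : ∀ l, 0 < η l)
    (hMN : ∀ l, M l ≤ N l) (hN : ∀ l, (2 : ℝ) ^ (M l + 2 * l) ≤ η l * 2 ^ N l) {l m : ℕ}
    (hm : m ≤ M l) :
    ‖(T ^ m) (((η l : 𝕜) * 2 ^ N l)⁻¹ • S.vec (true, l, N l))‖ ≤
      (1 / 2 : ℝ) ^ l * (1 / 2 : ℝ) ^ l := by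
  obtain ⟨j, hj⟩ := Nat.exists_eq_add_of_le (hm.trans (hMN l))
  have hv := h.pow_true_add l m j hj.ge
  rw [← hj] at hv
  have hηl := hη l
  rw [map_smul, hv, norm_smul, norm_smul, norm_inv, norm_mul, norm_pow, norm_pow,
    RCLike.norm_ofNat, RCLike.norm_ofReal, abs_of_pos hηl]
  calc (η l * 2 ^ N l)⁻¹ * (2 ^ m * ‖S.vec (true, l, j)‖)
      ≤ ((2 : ℝ) ^ (M l + 2 * l))⁻¹ * (2 ^ M l * 1) := by
        gcongr
        · exact hN l
        · norm_num
        · exact S.norm_vec_le _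
    _ = (1 / 2 : ℝ) ^ l * (1 / 2 : ℝ) ^ l := by
      rw [pow_add, two_mul, pow_add, one_div, inv_pow]
      field_simp

theorem exists_approximating_vector [CompleteSpace X] (h : S.IsModel M N η ρ κ u w T)
    (hη : ∀ l, 0 < η l) (hMN : ∀ l, M l ≤ N l)
    (hN : ∀ l, (2 : ℝ) ^ (M l + 2 * l) ≤ η l * 2 ^ N l) :
    ∃ x, ∀ k, ‖(T ^ (N k + 1)) x - (u k + (κ : 𝕜) • w k)‖ ≤ (1 / 2 : ℝ) ^ k * 2 := by
  let s : ℕ → X := fun l => ((η l : 𝕜) * 2 ^ N l)⁻¹ • S.vec (true, l, N l)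
  have hs {l m : ℕ} (hm : m ≤ M l) : ‖(T ^ m) (s l)‖ ≤ (1 / 2 : ℝ) ^ l * (1 / 2 : ℝ) ^ l :=
    h.norm_pow_smul_top_le hη hMN hN hm
  have hsum : Summable s := by
    refine Summable.of_norm_bounded summable_geometric_two fun l => ?_
    refine (hs (m := 0) (Nat.zero_le _)).trans ?_
    exact mul_le_of_le_one_left (by positivity) (pow_le_one₀ (by norm_num) (by norm_num))
  refine ⟨∑' l, s l, fun k => ?_⟩
  have hk : (T ^ (N k + 1)) (s k) = u k + (κ : 𝕜) • w k := by
    have h2 := h.pow_true_add_succ (le_refl (N k)) 0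
    rw [zero_add, pow_zero, one_apply_eq_self] at h2
    have hη0 : (η k : 𝕜) ≠ 0 := RCLike.ofReal_ne_zero.2 (hη k).ne'
    rw [map_smul, h2, smul_smul, mul_comm (2 ^ N k : 𝕜), inv_mul_cancel₀, one_smul]
    exact mul_ne_zero hη0 (pow_ne_zero _ two_ne_zero)
  have h1 := (hsum.hasSum.mapL (T ^ (N k + 1))).sub (hasSum_ite_eq k (u k + (κ : 𝕜) • w k))
  refine h1.norm_le_of_bounded (hasSum_geometric_two.mul_left _) fun l => ?_
  split_ifs with hl
  · rw [hl, hk, sub_self, norm_zero]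
    positivity
  rw [sub_zero]
  rcases lt_or_gt_of_ne hl with hl | hl
  · have hmem : s l ∈ S.low (l + 1) := Submodule.smul_mem _ _ (vec_mem_low l.lt_succ_self)
    have hle : M (l + 1) ≤ N k + 1 := ((h.monotone hl).trans (hMN k)).trans (Nat.le_succ _)
    rw [ContinuousLinearMap.pow_apply_eq_zero_of_le (h.pow_eq_zero_of_mem_low hmem) hle, norm_zero]
    positivity
  · have hM := h.monotone hl
    have := h.step_le k
    simp only [Nat.succ_eq_add_one] at hM
    refine (hs (by omega)).trans ?_
    gcongr ?_ * _
    exact pow_le_pow_of_le_one (by norm_num) (by norm_num) hl.le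

theorem exists_eps_hypercyclic_vector [CompleteSpace X] (h : S.IsModel M N η ρ κ u w T)
    (hη : ∀ l, 0 < η l) (hMN : ∀ l, M l ≤ N l)
    (hN : ∀ l, (2 : ℝ) ^ (M l + 2 * l) ≤ η l * 2 ^ N l) {ε : ℝ} (hε : 0 < ε) (hε1 : ε ≤ 1)
    (hw : ∀ l, ‖(κ : 𝕜) • w l‖ ≤ ε / 2 * ‖u l‖)
    (hu : ∀ x : X, ∀ δ > 0, ∀ K : ℕ, ∃ l ≥ K, ‖u l - x‖ < δ) :
    ∃ x : X, ∀ y : X, y ≠ 0 → ∃ n : ℕ, ‖(T ^ n) x - y‖ ≤ ε * ‖y‖ := by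
  obtain ⟨x, hx⟩ := h.exists_approximating_vector hη hMN hN
  refine ⟨x, fun y hy => ?_⟩
  have hy' : 0 < ‖y‖ := norm_pos_iff.2 hy
  have hθ : 0 < ε * ‖y‖ / 16 := by positivity
  obtain ⟨K, hK⟩ := exists_pow_lt_of_lt_one hθ (show (1 / 2 : ℝ) < 1 by norm_num)
  obtain ⟨k, hk, hky⟩ := hu y _ hθ K
  have hpow : (1 / 2 : ℝ) ^ k ≤ (1 / 2 : ℝ) ^ K :=
    pow_le_pow_of_le_one (by norm_num) (by norm_num) hk
  refine ⟨N k + 1, ?_⟩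
  have hdecomp : (T ^ (N k + 1)) x - y =
      ((T ^ (N k + 1)) x - (u k + (κ : 𝕜) • w k)) + (u k - y) + (κ : 𝕜) • w k := by abel
  have huk : ‖u k‖ ≤ ‖u k - y‖ + ‖y‖ := by simpa using norm_add_le (u k - y) y
  have hwk : ‖(κ : 𝕜) • w k‖ ≤ ε / 2 * (ε * ‖y‖ / 16 + ‖y‖) :=
    (hw k).trans (by gcongr; linarith)
  rw [hdecomp]
  refine (norm_add₃_le).trans ?_
  have := hx k
  nlinarith

end ChainSystem.IsModel

namespace ChainSystem

theorem exists_seq_mem_low [TopologicalSpace.SeparableSpace X] (S : ChainSystem 𝕜 X) :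
    ∃ u : ℕ → X, (∀ l, u l ∈ S.low l) ∧
      ∀ x : X, ∀ δ > 0, ∀ K : ℕ, ∃ l ≥ K, ‖u l - x‖ < δ := by
  classical
  have := UniformSpace.secondCountable_of_separable X
  let D : Set X := ⋃ n, (S.low n : Set X)
  have : Nonempty D := ⟨0, Set.mem_iUnion.2 ⟨0, (S.low 0).zero_mem⟩⟩
  let d : ℕ → X := fun i => TopologicalSpace.denseSeq D i
  refine ⟨fun l => if d l.unpair.1 ∈ S.low l then d l.unpair.1 else 0, fun l => ?_,
    fun x δ hδ K => ?_⟩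
  · dsimp only
    split_ifs with h
    · exact h
    · exact Submodule.zero_mem _
  · obtain ⟨y, hyD, hy⟩ := (dense_iUnion_low (S := S)).exists_dist_lt x (half_pos hδ)
    obtain ⟨i, hi⟩ := (TopologicalSpace.denseRange_denseSeq D).exists_dist_lt
      ⟨y, hyD⟩ (half_pos hδ)
    obtain ⟨n, hn⟩ := Set.mem_iUnion.1 (TopologicalSpace.denseSeq D i).2
    have hle := Nat.right_le_pair i (max K n)
    refine ⟨Nat.pair i (max K n), (le_max_left _ _).trans hle, ?_⟩
    have hmem : d i ∈ S.low (Nat.pair i (max K n)) := low_mono ((le_max_right _ _).trans hle) hn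
    simp only [Nat.unpair_pair, if_pos hmem]
    rw [← dist_eq_norm, dist_comm]
    have hi' : dist y (d i) < δ / 2 := hi
    linarith [dist_triangle x y (d i)]

end ChainSystem

end

/-- The recursive choice of chain lengths and feeding coefficients. -/
theorem exists_chain_lengths {τ G : ℝ} (hτ : 0 < τ) (hG : 0 < G) (a : ℕ → ℝ) (ha : ∀ l, 0 ≤ a l) :
    ∃ (M N : ℕ → ℕ) (η : ℕ → ℝ), M 0 = 1 ∧ (∀ l, M (l + 1) = N l + 1 + M l) ∧ (∀ l, 0 < η l) ∧
      (∀ l, M l ≤ N l) ∧ (∀ l, (2 : ℝ) ^ (M l + 2 * l) ≤ η l * 2 ^ N l) ∧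
      ∀ l, η l * (4 * τ) ^ M l * a l * G ≤ (1 / 2 : ℝ) ^ (l + 1) := by
  let E : ℕ → ℕ → ℝ := fun l m => (1 / 2 : ℝ) ^ (l + 1) / ((4 * τ) ^ m * (1 + a l) * G)
  have hden (l m : ℕ) : 0 < (4 * τ) ^ m * (1 + a l) * G := by
    have := ha l
    positivity
  have hE (l m : ℕ) : 0 < E l m := div_pos (by positivity) (hden l m)
  have hF (l m : ℕ) : ∃ n, m ≤ n ∧ (2 : ℝ) ^ (m + 2 * l) ≤ E l m * 2 ^ n := by
    obtain ⟨n, hn⟩ := pow_unbounded_of_one_lt ((2 : ℝ) ^ (m + 2 * l) / E l m) one_lt_two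
    refine ⟨max m n, le_max_left _ _, ?_⟩
    rw [div_lt_iff₀' (hE l m)] at hn
    refine hn.le.trans ?_
    have := hE l m
    gcongr
    · norm_num
    · exact le_max_right _ _
  choose F hF1 hF2 using hF
  let M : ℕ → ℕ := fun l => Nat.rec 1 (fun l m => F l m + 1 + m) l
  refine ⟨M, fun l => F l (M l), fun l => E l (M l), rfl, fun l => rfl, fun l => hE _ _,
    fun l => hF1 _ _, fun l => hF2 _ _, fun l => ?_⟩
  have hal := ha l
  calc E l (M l) * (4 * τ) ^ M l * a l * G
      ≤ E l (M l) * (4 * τ) ^ M l * (1 + a l) * G := by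
        have := hE l (M l)
        gcongr
        linarith
    _ = E l (M l) * ((4 * τ) ^ M l * (1 + a l) * G) := by ring
    _ = (1 / 2 : ℝ) ^ (l + 1) := div_mul_cancel₀ _ (hden l (M l)).ne'

/-- A separable Banach space with a chain system carries, for each `ε ∈ (0, 1)`, an operator
which is ε-hypercyclic but not hypercyclic. -/
theorem ChainSystem.exists_eps_hypercyclic_not_hypercyclic {𝕜 X : Type*} [RCLike 𝕜]
    [NormedAddCommGroup X] [NormedSpace 𝕜 X] [CompleteSpace X]
    [TopologicalSpace.SeparableSpace X] (S : ChainSystem 𝕜 X) {ε : ℝ} (hε : 0 < ε) (hε1 : ε ≤ 1) :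
    ∃ T : X →L[𝕜] X,
      (∃ x : X, ∀ u : X, u ≠ 0 → ∃ n : ℕ, ‖(T ^ n) x - u‖ ≤ ε * ‖u‖) ∧
      ¬ ∃ x : X, Dense (Set.range fun n : ℕ => (T ^ n) x) := by
  obtain ⟨u, hlow, hdense⟩ := S.exists_seq_mem_low
  have hK := S.shiftBound_nonneg
  have hKf : 0 ≤ S.coordBound := (norm_nonneg _).trans (S.norm_coord_le (true, 0, 0))
  have hf₀ := norm_nonneg S.coord₀
  set κ : ℝ := ε / (4 * (‖S.coord₀‖ + 1)) with hκ
  have hκ0 : 0 < κ := by positivity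
  have hκKf : 0 ≤ κ⁻¹ * S.coordBound := by positivity
  have hκε : κ * (2 * ‖S.coord₀‖) ≤ ε / 2 := by
    have : κ * (4 * (‖S.coord₀‖ + 1)) = ε := div_mul_cancel₀ _ (by positivity)
    nlinarith
  set τ : ℝ := 2 * (2 * S.shiftBound + 1) * S.shiftBound + 1
  have hτ : 1 ≤ τ := le_add_of_nonneg_left (by positivity)
  set G : ℝ := ‖S.coord₀‖ + κ⁻¹ * S.coordBound + 2 * S.coordBound + 1
  have hG : 0 < G := by positivity
  obtain ⟨M, N, η, hM0, hM, hη, hMN, hN, hsmall⟩ :=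
    exists_chain_lengths (zero_lt_one.trans_le hτ) hG
    (fun l => ‖u l‖) fun l => norm_nonneg _
  have hM1 (l : ℕ) : 1 ≤ M l := by
    cases l with
    | zero => exact hM0.ge
    | succ l => rw [hM]; omega
  have hfeed (l : ℕ) : S.coordBound * (η l * (2 * ‖u l‖)) ≤ (1 / 2 : ℝ) ^ (l + 1) := by
    refine le_trans ?_ (hsmall l)
    have hηl := hη l
    calc S.coordBound * (η l * (2 * ‖u l‖)) = η l * 1 * ‖u l‖ * (2 * S.coordBound) := by ring
      _ ≤ η l * (4 * τ) ^ M l * ‖u l‖ * G := by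
        gcongr
        · exact one_le_pow₀ (by linarith)
        · linarith
  obtain ⟨T, w, hT, hTn, hw⟩ := S.exists_isModel M N η κ ε u hM1 (fun l => (hM l).ge) hlow
    (fun l => (hη l).le) hfeed hκ0.le hκε hε1
  refine ⟨T, hT.exists_eps_hypercyclic_vector hη hMN hN hε hε1 hw hdense, ?_⟩
  rintro ⟨x, hx⟩
  exact hT.not_dense_orbit hM0 (by positivity) hκ0 hτ hTn (by linarith) (fun l => (hη l).le)
    hsmall x hx

/-- A complemented copy of a space with a symmetric basis yields a chain system. -/
theorem SymmetricBasis.nonempty_chainSystem_of_closedComplemented {𝕜 X Z : Type*} [RCLike 𝕜]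
    [NormedAddCommGroup X] [NormedSpace 𝕜 X] [NormedAddCommGroup Z] [NormedSpace 𝕜 Z]
    (B : SymmetricBasis 𝕜 Z) {V : Submodule 𝕜 X} (hV : V.ClosedComplemented) (Φ : V ≃L[𝕜] Z) :
    Nonempty (ChainSystem 𝕜 X) := by
  obtain ⟨P, hP⟩ := hV
  exact B.nonempty_chainSystem (V.subtypeL.comp (Φ.symm : Z →L[𝕜] V))
    ((Φ : V →L[𝕜] Z).comp P) fun z => by simp [hP]

/-- If a separable Banach space `X` contains a complemented closed subspace isomorphic to
`c₀(ℕ)` or to `ℓᵖ(ℕ)` for some `p ∈ [1,∞)`, then for every `ε ∈ (0,1)` the space `X` admits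
a bounded operator which is ε-hypercyclic but not hypercyclic. -/
theorem eps_hypercyclic_not_hypercyclic_of_complemented_c0_or_lp
    {𝕜 X : Type*} [RCLike 𝕜] [NormedAddCommGroup X] [NormedSpace 𝕜 X]
    [CompleteSpace X] [TopologicalSpace.SeparableSpace X]
    (h : (∃ V : Submodule 𝕜 X, V.ClosedComplemented ∧
            Nonempty (V ≃L[𝕜] ZeroAtInftyContinuousMap ℕ 𝕜)) ∨
         (∃ p : ℝ≥0∞, ∃ hp : Fact (1 ≤ p), p ≠ ⊤ ∧
            (letI := hp
             ∃ V : Submodule 𝕜 X, V.ClosedComplemented ∧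
               Nonempty (V ≃L[𝕜] lp (fun _ : ℕ => 𝕜) p))))
    {ε : ℝ} (hε : ε ∈ Set.Ioo (0 : ℝ) 1) :
    ∃ T : X →L[𝕜] X,
      (∃ x : X, ∀ u : X, u ≠ 0 → ∃ n : ℕ, ‖(T ^ n) x - u‖ ≤ ε * ‖u‖) ∧
      ¬ ∃ x : X, Dense (Set.range fun n : ℕ => (T ^ n) x) := by
  have hS : Nonempty (ChainSystem 𝕜 X) := by
    rcases h with ⟨V, hV, ⟨Φ⟩⟩ | ⟨p, hp, hpt, V, hV, ⟨Φ⟩⟩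
    · exact c0SymmetricBasis.nonempty_chainSystem_of_closedComplemented hV Φ
    · exact (lpSymmetricBasis p hpt).nonempty_chainSystem_of_closedComplemented hV Φ
  obtain ⟨S⟩ := hS
  exact S.exists_eps_hypercyclic_not_hypercyclic hε.1 hε.2.le
end

section
/- Let p ∈ [1,∞) and let X be a nonzero separable Banach space. Then for every ε ∈ (0,1), the Banach space ℓ^p(X) of all sequences (x_n) in X with Σ_n ‖x_n‖^p < ∞, equipped with the norm ‖(x_n)‖ = (Σ_n ‖x_n‖^p)^{1/p}, admits a bounded linear operator that is ε-hypercyclic but not hypercyclic. -/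
open Filter Topology ENNReal

section shift

variable {𝕜 X : Type*} [RCLike 𝕜] [NormedAddCommGroup X] [NormedSpace 𝕜 X]
  {p : ℝ≥0∞} [Fact (1 ≤ p)]

/-- A weighted backward shift with bounded weights is a bounded operator on `ℓᵖ(X)`. -/
theorem exists_weightedShift (hp : p ≠ ⊤) (s : ℕ → 𝕜) {C : ℝ} (hC : 0 ≤ C)
    (hs : ∀ i, ‖s i‖ ≤ C) :
    ∃ S : lp (fun _ : ℕ => X) p →L[𝕜] lp (fun _ : ℕ => X) p,
      (∀ y i, S y i = s (i + 1) • y (i + 1)) ∧ ‖S‖ ≤ C := by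
  have hp0 : 0 < p.toReal :=
    ENNReal.toReal_pos (zero_lt_one.trans_le (Fact.out : 1 ≤ p)).ne' hp
  have key (y : lp (fun _ : ℕ => X) p) (F : Finset ℕ) :
      ∑ i ∈ F, ‖s (i + 1) • y (i + 1)‖ ^ p.toReal ≤ (C * ‖y‖) ^ p.toReal := by
    calc ∑ i ∈ F, ‖s (i + 1) • y (i + 1)‖ ^ p.toReal
        ≤ ∑ i ∈ F, C ^ p.toReal * ‖y (i + 1)‖ ^ p.toReal := by
          refine Finset.sum_le_sum fun i _ => ?_
          rw [← Real.mul_rpow hC (norm_nonneg _), norm_smul]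
          have := hs (i + 1)
          gcongr
      _ = C ^ p.toReal * ∑ i ∈ F.map (addRightEmbedding 1), ‖y i‖ ^ p.toReal := by
          rw [← Finset.mul_sum, Finset.sum_map]; rfl
      _ ≤ C ^ p.toReal * ‖y‖ ^ p.toReal := by
          gcongr
          exact lp.sum_rpow_le_norm_rpow hp0 y _
      _ = (C * ‖y‖) ^ p.toReal := (Real.mul_rpow hC (norm_nonneg _)).symm
  let L : lp (fun _ : ℕ => X) p →ₗ[𝕜] lp (fun _ : ℕ => X) p :=
    { toFun := fun y => ⟨fun i => s (i + 1) • y (i + 1), memℓp_gen' (key y)⟩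
      map_add' := fun y z => by ext i; exact smul_add _ _ _
      map_smul' := fun a y => by ext i; exact smul_comm _ _ _ }
  have hL (y) : ‖L y‖ ≤ C * ‖y‖ :=
    lp.norm_le_of_forall_sum_le hp0 (by positivity) (key y)
  exact ⟨L.mkContinuous C hL, fun y i => rfl, L.mkContinuous_norm_le hC hL⟩

/-- Coordinates of the powers of a weighted backward shift. -/
theorem weightedShift_pow_apply {S : lp (fun _ : ℕ => X) p →L[𝕜] lp (fun _ : ℕ => X) p}
    {s : ℕ → 𝕜} (hS : ∀ y i, S y i = s (i + 1) • y (i + 1)) (m : ℕ)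
    (y : lp (fun _ : ℕ => X) p) (j : ℕ) :
    (S ^ m) y j = (∏ r ∈ Finset.range m, s (j + r + 1)) • y (j + m) := by
  induction m generalizing j with
  | zero => simp
  | succ m ih =>
    rw [pow_succ', mul_apply_eq_comp, hS, ih,
      Finset.prod_range_succ', smul_smul, mul_comm, show j + 1 + m = j + (m + 1) by ring]
    congr 2
    exact Finset.prod_congr rfl fun r _ => by rw [show j + 1 + r = j + (r + 1) by ring]

/-- Expansion of the powers of a perturbed operator. -/
theorem add_pow_eq_sum {R : Type*} [Ring R] (S K : R) (n : ℕ) :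
    (S + K) ^ n = S ^ n + ∑ i ∈ Finset.range n, (S + K) ^ i * K * S ^ (n - 1 - i) := by
  induction n with
  | zero => simp
  | succ n ih =>
    rw [pow_succ', ih, Finset.sum_range_succ']
    have : ∑ i ∈ Finset.range n, (S + K) ^ (i + 1) * K * S ^ (n + 1 - 1 - (i + 1)) =
        (S + K) * ∑ i ∈ Finset.range n, (S + K) ^ i * K * S ^ (n - 1 - i) := by
      rw [Finset.mul_sum]
      refine Finset.sum_congr rfl fun i _ => ?_
      rw [pow_succ', show n + 1 - 1 - (i + 1) = n - 1 - i by omega]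
      simp only [mul_assoc]
    rw [this]
    simp only [add_tsub_cancel_right, Nat.sub_zero, pow_zero, one_mul, mul_add, add_mul, pow_succ']
    abel

theorem norm_pow_apply_le {E : Type*} [NormedAddCommGroup E] [NormedSpace 𝕜 E]
    {A : E →L[𝕜] E} {C : ℝ} (hA : ‖A‖ ≤ C) (m : ℕ) (y : E) : ‖(A ^ m) y‖ ≤ C ^ m * ‖y‖ := by
  have hC : 0 ≤ C := (norm_nonneg A).trans hA
  induction m with
  | zero => simp
  | succ m ih =>
    rw [pow_succ', mul_apply_eq_comp, pow_succ', mul_assoc]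
    exact A.le_of_opNorm_le_of_le hA ih

/-- An absolutely convergent series of rank one operators. -/
theorem exists_rankOne_series {E : Type*} [NormedAddCommGroup E] [NormedSpace 𝕜 E]
    [CompleteSpace E] (f : ℕ → E →L[𝕜] 𝕜) (u : ℕ → E)
    (h : ∀ j, ‖f j‖ * ‖u j‖ ≤ 1 / 2 / 2 ^ j) :
    ∃ K : E →L[𝕜] E, (∀ y, HasSum (fun j => f j y • u j) (K y)) ∧ ‖K‖ ≤ 1 := by
  have hb (j : ℕ) : ‖(f j).smulRight (u j)‖ ≤ 1 / 2 / 2 ^ j := by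
    rw [ContinuousLinearMap.norm_smulRight_apply]; exact h j
  have hs : Summable fun j => (f j).smulRight (u j) :=
    .of_norm_bounded (hasSum_geometric_two' 1).summable hb
  refine ⟨∑' j, (f j).smulRight (u j), fun y => ?_,
    tsum_of_norm_bounded (hasSum_geometric_two' 1) hb⟩
  simpa using hs.hasSum.mapL (ContinuousLinearMap.apply 𝕜 E y)

/-- In `ℓᵖ(X)` with `X` separable there is a sequence of vectors of prescribed growth and
support which approximates every vector along arbitrarily large indices. -/
theorem exists_frequently_dense_seq [TopologicalSpace.SeparableSpace X] (hp : p ≠ ⊤) :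
    ∃ u : ℕ → lp (fun _ : ℕ => X) p, (∀ k, ‖u k‖ ≤ 2 ^ (16 ^ k)) ∧
      (∀ k i, 16 ^ k ≤ i → u k i = 0) ∧
      ∀ v, ∀ η > 0, ∀ k₀, ∃ k ≥ k₀, ‖u k - v‖ < η := by
  classical
  let F (n : ℕ) (x : Fin n → X) : lp (fun _ : ℕ => X) p :=
    ∑ i : Fin n, lp.single (E := fun _ : ℕ => X) p (i : ℕ) (x i)
  have hF (n : ℕ) : Continuous (F n) := by
    refine continuous_finsetSum _ fun i _ => ?_
    exact (lp.isometry_single (E := fun _ : ℕ => X) (p := p) (i : ℕ)).continuous.comp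
      (continuous_apply i)
  have hFs (n x i) (hi : n ≤ i) : F n x i = 0 := by
    simp only [F, lp.coeFn_sum, Finset.sum_apply]
    exact Finset.sum_eq_zero fun j _ => lp.single_apply_ne _ _ _ (by have := j.2; omega)
  have hsep : TopologicalSpace.IsSeparable (⋃ n, Set.range (F n)) :=
    .iUnion fun n => TopologicalSpace.isSeparable_range (hF n)
  have hdense (v : lp (fun _ : ℕ => X) p) : v ∈ closure (⋃ n, Set.range (F n)) := by
    refine mem_closure_of_tendsto (lp.hasSum_single hp v).tendsto_sum_nat (.of_forall fun n => ?_)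
    refine Set.mem_iUnion.2 ⟨n, fun i => v i, ?_⟩
    exact Fin.sum_univ_eq_sum_range (fun i => lp.single (E := fun _ : ℕ => X) p i (v i)) n
  obtain ⟨t, htF, htc, htd⟩ := hsep.exists_countable_dense_subset
  have htd' (v : lp (fun _ : ℕ => X) p) : v ∈ closure t :=
    closure_minimal htd isClosed_closure (hdense v)
  have htn : t.Nonempty := closure_nonempty_iff.1 ⟨0, htd' 0⟩
  obtain ⟨a, rfl⟩ := htc.exists_eq_range htn
  let P (k : ℕ) (v : lp (fun _ : ℕ => X) p) : Prop :=
    ‖v‖ ≤ 2 ^ (16 ^ k) ∧ ∀ i, 16 ^ k ≤ i → v i = 0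
  refine ⟨fun k => if P k (a k.unpair.2) then a k.unpair.2 else 0, fun k => ?_, fun k => ?_, ?_⟩
  · dsimp only
    split_ifs with h
    · exact h.1
    · simp
  · dsimp only
    split_ifs with h
    · exact h.2
    · simp
  · intro v η hη k₀
    obtain ⟨_, ⟨b, rfl⟩, hb⟩ := Metric.mem_closure_iff.1 (htd' v) η hη
    obtain ⟨n, x, hx⟩ := Set.mem_iUnion.1 (htF ⟨b, rfl⟩)
    obtain ⟨N, hN⟩ := exists_nat_ge ‖a b‖
    let A := k₀ + n + N
    have hk : A ≤ Nat.pair A b := Nat.left_le_pair _ _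
    have hpow : Nat.pair A b ≤ 16 ^ Nat.pair A b := (Nat.lt_pow_self (by norm_num)).le
    refine ⟨Nat.pair A b, by omega, ?_⟩
    have hP : P (Nat.pair A b) (a b) := by
      refine ⟨hN.trans ?_, fun i hi => ?_⟩
      · have : N ≤ 2 ^ (16 ^ Nat.pair A b) :=
          le_trans (by omega : N ≤ 16 ^ Nat.pair A b) (Nat.lt_pow_self (by norm_num)).le
        exact_mod_cast this
      · rw [← hx]; exact hFs n x i (by omega)
    simp only [Nat.unpair_pair, hP, if_true]
    rw [← dist_eq_norm, dist_comm]
    exact hb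

end shift

/-- A weighted backward shift `S` on `ℓᵖ(X)`, perturbed by a series `K` of rank one operators.
The block `[16ᵏ, 16ᵏ⁺¹)` is cut off from the previous one; a vector travels down its upper part,
the chain, and on leaving the coordinate `2 * 16ᵏ` it produces a multiple of `u k`, and a
vector of comparable size which then travels down the lower part of the block. The operator `S'`
is the part of the shift which acts on the chains. -/
structure PerturbedShift (𝕜 X : Type*) [RCLike 𝕜] [NormedAddCommGroup X] [NormedSpace 𝕜 X]
    (p : ℝ≥0∞) [Fact (1 ≤ p)] where
  u : ℕ → lp (fun _ : ℕ => X) p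
  norm_u_le : ∀ k, ‖u k‖ ≤ 2 ^ (16 ^ k)
  u_apply : ∀ k i, 16 ^ k ≤ i → u k i = 0
  c : ℝ
  c_pos : 0 < c
  c_le : c ≤ 1
  φ : X →L[𝕜] 𝕜
  norm_φ_le : ∀ v, ‖φ v‖ ≤ ‖v‖
  x₀ : X
  norm_x₀ : ‖x₀‖ = 1
  φ_x₀ : φ x₀ = 1
  s : ℕ → 𝕜
  s_boundary : ∀ k, s (16 ^ k) = 0
  s_mark : ∀ k i, 16 ^ k < i → i < 2 * 16 ^ k → s i = 6
  s_exit : ∀ k, s (2 * 16 ^ k) = 2⁻¹ ^ (8 * 16 ^ k) * ((c * ‖u k‖ : ℝ) : 𝕜)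
  s_chain : ∀ k i, 2 * 16 ^ k < i → i < 16 ^ (k + 1) → s i = 2
  S : lp (fun _ : ℕ => X) p →L[𝕜] lp (fun _ : ℕ => X) p
  S_apply : ∀ y i, S y i = s (i + 1) • y (i + 1)
  norm_S_le : ‖S‖ ≤ 6
  s' : ℕ → 𝕜
  s'_mark : ∀ k i, 16 ^ k ≤ i → i ≤ 2 * 16 ^ k → s' i = 0
  s'_chain : ∀ k i, 2 * 16 ^ k < i → i < 16 ^ (k + 1) → s' i = 2
  S' : lp (fun _ : ℕ => X) p →L[𝕜] lp (fun _ : ℕ => X) p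
  S'_apply : ∀ y i, S' y i = s' (i + 1) • y (i + 1)
  norm_S'_le : ‖S'‖ ≤ 2
  K : lp (fun _ : ℕ => X) p →L[𝕜] lp (fun _ : ℕ => X) p
  hasSum_K : ∀ y, HasSum (fun j => (2⁻¹ ^ (8 * 16 ^ j) * φ (y (2 * 16 ^ j))) • u j) (K y)
  norm_K_le : ‖K‖ ≤ 1

namespace PerturbedShift

section

variable {𝕜 X : Type*} [RCLike 𝕜] [NormedAddCommGroup X] [NormedSpace 𝕜 X]
  {p : ℝ≥0∞} [Fact (1 ≤ p)]

theorem succ_le_sixteen_pow (k : ℕ) : k + 1 ≤ 16 ^ k := Nat.lt_pow_self (by norm_num)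

theorem sixteen_pow_succ_le {j k : ℕ} (h : j < k) : 16 * 16 ^ j ≤ 16 ^ k := by
  rw [mul_comm, ← pow_succ]
  exact Nat.pow_le_pow_right (by norm_num) h

theorem norm_apply_le (y : lp (fun _ : ℕ => X) p) (i : ℕ) : ‖y i‖ ≤ ‖y‖ :=
  lp.norm_apply_le_norm (zero_lt_one.trans_le (Fact.out : 1 ≤ p)).ne' y i

theorem exists_perturbedShift [CompleteSpace X] [Nontrivial X] (hp : p ≠ ⊤)
    (u : ℕ → lp (fun _ : ℕ => X) p) (hu : ∀ k, ‖u k‖ ≤ 2 ^ (16 ^ k))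
    (hu' : ∀ k i, 16 ^ k ≤ i → u k i = 0) (c : ℝ) (hc : 0 < c) (hc' : c ≤ 1) :
    ∃ D : PerturbedShift 𝕜 X p, D.u = u ∧ D.c = c := by
  obtain ⟨x₁, hx₁⟩ := exists_ne (0 : X)
  obtain ⟨x₀, hx₀⟩ : ∃ x₀ : X, ‖x₀‖ = 1 := ⟨_, norm_smul_inv_norm (𝕜 := 𝕜) hx₁⟩
  obtain ⟨φ, hφ, hφx⟩ := exists_dual_vector 𝕜 x₀ (by simp [hx₀])
  have hlog (k i : ℕ) (h1 : 16 ^ k ≤ i) (h2 : i < 16 ^ (k + 1)) : Nat.log 16 i = k :=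
    Nat.log_eq_of_pow_le_of_lt_pow h1 h2
  have hpos (k : ℕ) : 0 < 16 ^ k := by positivity
  let s (i : ℕ) : 𝕜 := if i = 16 ^ Nat.log 16 i then 0 else
    if i < 2 * 16 ^ Nat.log 16 i then 6 else
    if i = 2 * 16 ^ Nat.log 16 i then
      2⁻¹ ^ (8 * 16 ^ Nat.log 16 i) * ((c * ‖u (Nat.log 16 i)‖ : ℝ) : 𝕜) else 2
  have hs (i : ℕ) : ‖s i‖ ≤ 6 := by
    dsimp only [s]
    split_ifs
    · simp
    · simp
    · generalize Nat.log 16 i = k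
      rw [norm_mul, norm_pow, norm_inv, RCLike.norm_ofNat, RCLike.norm_ofReal,
        abs_of_nonneg (by positivity)]
      calc (2⁻¹ : ℝ) ^ (8 * 16 ^ k) * (c * ‖u k‖)
          ≤ 2⁻¹ ^ (1 * 16 ^ k) * (1 * 2 ^ (16 ^ k)) := by
            gcongr ?_ * (?_ * ?_)
            · exact pow_le_pow_of_le_one (by norm_num) (by norm_num) (by gcongr; norm_num)
            · exact hu k
        _ = 1 := by rw [one_mul, one_mul, ← mul_pow]; norm_num
        _ ≤ 6 := by norm_num
    · simp; norm_num
  let s' (i : ℕ) : 𝕜 := if 2 * 16 ^ Nat.log 16 i < i then 2 else 0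
  have hs' (i : ℕ) : ‖s' i‖ ≤ 2 := by
    dsimp only [s']
    split_ifs <;> simp
  obtain ⟨S, hS, hSn⟩ := exists_weightedShift (X := X) hp s (by norm_num) hs
  obtain ⟨S', hS', hSn'⟩ := exists_weightedShift (X := X) hp s' (by norm_num) hs'
  have hφn (v : X) : ‖φ v‖ ≤ ‖v‖ := by simpa [hφ] using φ.le_opNorm v
  let f (j : ℕ) : lp (fun _ : ℕ => X) p →L[𝕜] 𝕜 :=
    (2⁻¹ ^ (8 * 16 ^ j) : 𝕜) • φ.comp (lp.evalCLM 𝕜 (fun _ : ℕ => X) p (2 * 16 ^ j))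
  have hf (j : ℕ) : ‖f j‖ ≤ 2⁻¹ ^ (8 * 16 ^ j) := by
    refine ContinuousLinearMap.opNorm_le_bound _ (by positivity) fun y => ?_
    change ‖(2⁻¹ ^ (8 * 16 ^ j) : 𝕜) • φ (y (2 * 16 ^ j))‖ ≤ _
    rw [norm_smul, norm_pow, norm_inv, RCLike.norm_ofNat]
    gcongr
    exact (hφn _).trans (norm_apply_le y _)
  obtain ⟨K, hK, hKn⟩ := exists_rankOne_series f u fun j => by
    calc ‖f j‖ * ‖u j‖ ≤ 2⁻¹ ^ (8 * 16 ^ j) * 2 ^ (16 ^ j) := by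
          gcongr
          · exact hf j
          · exact hu j
      _ = 2⁻¹ ^ (7 * 16 ^ j) := by
          rw [show 8 * 16 ^ j = 7 * 16 ^ j + 16 ^ j by ring, pow_add, mul_assoc, ← mul_pow]
          norm_num
      _ ≤ 2⁻¹ ^ (1 + j) := by
          refine pow_le_pow_of_le_one (by norm_num) (by norm_num) ?_
          have := succ_le_sixteen_pow j
          omega
      _ = 1 / 2 / 2 ^ j := by rw [pow_add, inv_pow, inv_pow]; ring
  refine ⟨⟨u, hu, hu', c, hc, hc', φ, hφn, x₀, hx₀, by rw [hφx, hx₀]; simp, s, fun k => ?_,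
    fun k i h1 h2 => ?_, fun k => ?_, fun k i h1 h2 => ?_, S, hS, hSn, s', fun k i h1 h2 => ?_,
    fun k i h1 h2 => ?_, S', hS', hSn', K, hK, hKn⟩, rfl, rfl⟩
  · have := hlog k (16 ^ k) le_rfl (by gcongr <;> norm_num)
    simp [s, this]
  · have := hpos k
    dsimp only [s]
    rw [hlog k i h1.le (by rw [pow_succ]; omega), if_neg (by omega), if_pos h2]
  · have := hpos k
    dsimp only [s]
    rw [hlog k (2 * 16 ^ k) (by omega) (by rw [pow_succ]; omega), if_neg (by omega),
      if_neg (by omega), if_pos rfl]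
  · have := hpos k
    dsimp only [s]
    rw [hlog k i (by omega) h2, if_neg (by omega), if_neg (by omega), if_neg (by omega)]
  · have := hpos k
    dsimp only [s']
    rw [hlog k i h1 (by rw [pow_succ]; omega), if_neg (by omega)]
  · dsimp only [s']
    rw [hlog k i (by omega) h2, if_pos h1]

variable (D : PerturbedShift 𝕜 X p)

/-- The perturbed operator. -/
noncomputable def T : lp (fun _ : ℕ => X) p →L[𝕜] lp (fun _ : ℕ => X) p := D.S + D.K

theorem T_def : D.T = D.S + D.K := rfl

theorem hasSum_K_apply (y : lp (fun _ : ℕ => X) p) (i : ℕ) :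
    HasSum (fun j => (2⁻¹ ^ (8 * 16 ^ j) * D.φ (y (2 * 16 ^ j))) • D.u j i) (D.K y i) :=
  (D.hasSum_K y).mapL (lp.evalCLM 𝕜 (fun _ : ℕ => X) p i)

theorem norm_T_pow_le (m : ℕ) (y : lp (fun _ : ℕ => X) p) : ‖(D.T ^ m) y‖ ≤ 8 ^ m * ‖y‖ := by
  have h : ‖D.T‖ ≤ 8 := (norm_add_le _ _).trans (by linarith [D.norm_S_le, D.norm_K_le])
  exact norm_pow_apply_le h m y

theorem norm_S_pow_le (m : ℕ) (y : lp (fun _ : ℕ => X) p) : ‖(D.S ^ m) y‖ ≤ 8 ^ m * ‖y‖ := by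
  have h : ‖D.S‖ ≤ 8 := D.norm_S_le.trans (by norm_num)
  exact norm_pow_apply_le h m y

theorem S_pow_apply (m : ℕ) (y : lp (fun _ : ℕ => X) p) (j : ℕ) :
    (D.S ^ m) y j = (∏ r ∈ Finset.range m, D.s (j + r + 1)) • y (j + m) :=
  weightedShift_pow_apply D.S_apply m y j

/-- The operator strictly lowers the support of finitely supported vectors. -/
theorem T_pow_apply_eq_zero {N : ℕ} {y : lp (fun _ : ℕ => X) p} (hy : ∀ i, N ≤ i → y i = 0)
    (m : ℕ) : ∀ i, N ≤ i + m → (D.T ^ m) y i = 0 := by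
  induction m with
  | zero => simpa using hy
  | succ m ih =>
    intro i hi
    rw [pow_succ', mul_apply_eq_comp]
    change D.S ((D.T ^ m) y) i + D.K ((D.T ^ m) y) i = 0
    rw [D.S_apply, ih (i + 1) (by omega), smul_zero, zero_add]
    refine (D.hasSum_K_apply _ i).unique ?_
    convert hasSum_zero with j
    by_cases h : N ≤ 2 * 16 ^ j + m
    · rw [ih _ h]; simp
    · rw [D.u_apply j i (by omega), smul_zero]

theorem T_pow_u_apply {k m i : ℕ} (h : 16 ^ k ≤ i + m) : (D.T ^ m) (D.u k) i = 0 :=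
  D.T_pow_apply_eq_zero (D.u_apply k) m i h

theorem T_pow_u_eq_zero {k m : ℕ} (h : 16 ^ k ≤ m) : (D.T ^ m) (D.u k) = 0 := by
  ext i
  exact D.T_pow_u_apply (by omega)

/-- On the coordinate `0` the part of the shift outside the chains is invisible. -/
theorem T_pow_apply_zero (y : lp (fun _ : ℕ => X) p) (m : ℕ) :
    (D.T ^ m) y 0 = ((D.S' + D.K) ^ m) y 0 := by
  suffices ∀ i, (∀ k, 16 ^ k ≤ i → 2 * 16 ^ k ≤ i) → (D.T ^ m) y i = ((D.S' + D.K) ^ m) y i from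
    this 0 fun k hk => by have : 0 < 16 ^ k := by positivity
                          omega
  induction m with
  | zero => simp
  | succ m ih =>
    intro i hi
    rw [pow_succ', pow_succ', mul_apply_eq_comp, mul_apply_eq_comp]
    change D.S ((D.T ^ m) y) i + D.K ((D.T ^ m) y) i =
      D.S' (((D.S' + D.K) ^ m) y) i + D.K (((D.S' + D.K) ^ m) y) i
    congr 1
    · rw [D.S_apply, D.S'_apply]
      set k := Nat.log 16 (i + 1) with hk
      have h1 : 16 ^ k ≤ i + 1 := Nat.pow_log_le_self 16 (by omega)
      have h2 : i + 1 < 16 ^ (k + 1) := Nat.lt_pow_succ_log_self (by norm_num) _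
      rcases h1.eq_or_lt with h | h
      · rw [D.s'_mark k (i + 1) h1 (by omega), ← h, D.s_boundary, zero_smul, zero_smul]
      · have h3 := hi k (by omega)
        rw [D.s_chain k _ (by omega) h2, D.s'_chain k _ (by omega) h2, ih]
        intro l hl
        rcases le_or_gt l k with hlk | hlk
        · have := Nat.pow_le_pow_right (show 16 > 0 by norm_num) hlk
          omega
        · have := Nat.pow_le_pow_right (show 16 > 0 by norm_num) (show k + 1 ≤ l from hlk)
          omega
    · refine (D.hasSum_K_apply _ i).unique ?_
      convert D.hasSum_K_apply (((D.S' + D.K) ^ m) y) i using 4 with j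
      rw [ih]
      intro l hl
      rcases le_or_gt l j with hlj | hlj
      · have := Nat.pow_le_pow_right (show 16 > 0 by norm_num) hlj
        omega
      · have := sixteen_pow_succ_le hlj
        have : 0 < 16 ^ j := by positivity
        omega

theorem norm_T_pow_apply_zero_le (y : lp (fun _ : ℕ => X) p) (m : ℕ) :
    ‖(D.T ^ m) y 0‖ ≤ 3 ^ m * ‖y‖ := by
  have h : ‖D.S' + D.K‖ ≤ 3 := (norm_add_le _ _).trans (by linarith [D.norm_S'_le, D.norm_K_le])
  rw [T_pow_apply_zero]
  exact (norm_apply_le _ _).trans (norm_pow_apply_le h m y)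

/-- The contribution of the `k`-th perturbation to the `n`-th power, at step `i`. -/
noncomputable def term (k n i : ℕ) (y : lp (fun _ : ℕ => X) p) : lp (fun _ : ℕ => X) p :=
  (2⁻¹ ^ (8 * 16 ^ k) * D.φ ((D.S ^ (n - 1 - i)) y (2 * 16 ^ k))) • (D.T ^ i) (D.u k)

theorem norm_term_le (k n i : ℕ) (y : lp (fun _ : ℕ => X) p) :
    ‖D.term k n i y‖ ≤ 2⁻¹ ^ (8 * 16 ^ k) * ‖(D.S ^ (n - 1 - i)) y (2 * 16 ^ k)‖ *
      ‖(D.T ^ i) (D.u k)‖ := by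
  rw [term, norm_smul, norm_mul, norm_pow, norm_inv, RCLike.norm_ofNat]
  gcongr
  exact D.norm_φ_le _

theorem term_eq_zero_of_lt {j k n i : ℕ} (hjk : j < k) (hn : 16 ^ k ≤ n) (hi : i < n)
    (y : lp (fun _ : ℕ => X) p) : D.term j n i y = 0 := by
  have h := sixteen_pow_succ_le hjk
  have hpos : 0 < 16 ^ j := by positivity
  rw [term]
  rcases le_or_gt (16 ^ j) i with hij | hij
  · rw [D.T_pow_u_eq_zero hij, smul_zero]
  · rw [S_pow_apply, Finset.prod_eq_zero (i := 14 * 16 ^ j - 1)]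
    · simp
    · rw [Finset.mem_range]; omega
    · rw [show 2 * 16 ^ j + (14 * 16 ^ j - 1) + 1 = 16 ^ (j + 1) by rw [pow_succ]; omega,
        D.s_boundary]

theorem norm_term_le_of_lt {j k n i : ℕ} (hkj : k < j) (hn : n < 16 ^ (k + 1)) (hi : i < n)
    (y : lp (fun _ : ℕ => X) p) :
    ‖D.term j n i y‖ ≤ 4⁻¹ ^ n * ‖y‖ / 2 / 2 ^ j := by
  have hnj : n < 16 ^ j := hn.trans_le (Nat.pow_le_pow_right (by norm_num) hkj)
  have hj := succ_le_sixteen_pow j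
  calc ‖D.term j n i y‖
      ≤ 2⁻¹ ^ (8 * 16 ^ j) * (8 ^ (n - 1 - i) * ‖y‖) * (8 ^ i * 2 ^ (16 ^ j)) := by
        refine (D.norm_term_le _ _ _ _).trans ?_
        gcongr
        · exact (norm_apply_le _ _).trans (D.norm_S_pow_le _ _)
        · exact (D.norm_T_pow_le _ _).trans (by gcongr; exact D.norm_u_le j)
    _ = 2⁻¹ ^ (8 * 16 ^ j) * 2 ^ (3 * (n - 1) + 16 ^ j) * ‖y‖ := by
        obtain ⟨m, hm⟩ : ∃ m, n - 1 - i = m := ⟨_, rfl⟩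
        rw [hm, show 3 * (n - 1) = 3 * m + 3 * i by omega, pow_add, pow_add,
          pow_mul 2 3 m, pow_mul 2 3 i, show (2 : ℝ) ^ 3 = 8 by norm_num]
        ring
    _ ≤ 2⁻¹ ^ (8 * 16 ^ j) * 2 ^ (8 * 16 ^ j - (2 * n + 1 + j)) * ‖y‖ := by
        gcongr
        · norm_num
        · omega
    _ = 2⁻¹ ^ (2 * n + 1 + j) * ‖y‖ := by
        congr 1
        obtain ⟨a, ha⟩ : ∃ a, 8 * 16 ^ j = (2 * n + 1 + j) + a :=
          ⟨_, (Nat.add_sub_of_le (by omega)).symm⟩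
        rw [ha, Nat.add_sub_cancel_left, pow_add, mul_assoc, ← mul_pow]
        norm_num
    _ = 4⁻¹ ^ n * ‖y‖ / 2 / 2 ^ j := by
        rw [pow_add, pow_add, pow_mul, inv_pow (2 : ℝ) j]
        norm_num
        ring

theorem norm_step_sub_term_le {k n i : ℕ} (hk : 16 ^ k ≤ n) (hn : n < 16 ^ (k + 1)) (hi : i < n)
    (y : lp (fun _ : ℕ => X) p) :
    ‖(D.T ^ i * D.K * D.S ^ (n - 1 - i)) y - D.term k n i y‖ ≤ 4⁻¹ ^ n * ‖y‖ := by
  have h : HasSum (fun j => D.term j n i y) ((D.T ^ i * D.K * D.S ^ (n - 1 - i)) y) := by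
    simpa [term] using (D.hasSum_K ((D.S ^ (n - 1 - i)) y)).mapL (D.T ^ i)
  have h' := h.update k 0
  rw [zero_sub, neg_add_eq_sub] at h'
  refine h'.norm_le_of_bounded (hasSum_geometric_two' _) fun j => ?_
  rcases lt_trichotomy j k with hj | rfl | hj
  · rw [Function.update_of_ne hj.ne, D.term_eq_zero_of_lt hj hk hi, norm_zero]
    positivity
  · rw [Function.update_self, norm_zero]
    positivity
  · rw [Function.update_of_ne hj.ne']
    exact D.norm_term_le_of_lt hj hn hi y

/-- For `n` in the `k`-th block, only the `k`-th perturbation matters in the `n`-th power. -/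
theorem norm_T_pow_sub_le {k n : ℕ} (hk : 16 ^ k ≤ n) (hn : n < 16 ^ (k + 1))
    (y : lp (fun _ : ℕ => X) p) :
    ‖(D.T ^ n) y - (D.S ^ n) y - ∑ i ∈ Finset.range n, D.term k n i y‖ ≤ 2⁻¹ ^ n * ‖y‖ := by
  have h : (D.T ^ n) y = (D.S ^ n) y +
      ∑ i ∈ Finset.range n, (D.T ^ i * D.K * D.S ^ (n - 1 - i)) y := by
    conv_lhs => rw [T_def, add_pow_eq_sum]
    simp only [add_apply, sum_apply, T_def]
  rw [h, add_sub_cancel_left, ← Finset.sum_sub_distrib]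
  calc _ ≤ ∑ i ∈ Finset.range n, (4⁻¹ : ℝ) ^ n * ‖y‖ :=
        norm_sum_le_of_le _ fun i hi =>
          D.norm_step_sub_term_le hk hn (Finset.mem_range.1 hi) y
    _ = n * 4⁻¹ ^ n * ‖y‖ := by rw [Finset.sum_const, Finset.card_range, nsmul_eq_mul, mul_assoc]
    _ ≤ 2 ^ n * 4⁻¹ ^ n * ‖y‖ := by
        gcongr
        exact_mod_cast (Nat.lt_two_pow_self (n := n)).le
    _ = 2⁻¹ ^ n * ‖y‖ := by rw [← mul_pow]; norm_num

theorem S_pow_apply_mark {k n i : ℕ} (hi : i < 16 ^ k) (hin : i < n)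
    (y : lp (fun _ : ℕ => X) p) :
    (D.S ^ n) y (2 * 16 ^ k - 1 - i) =
      (6 ^ i * D.s (2 * 16 ^ k)) • (D.S ^ (n - 1 - i)) y (2 * 16 ^ k) := by
  rw [show n = (i + 1) + (n - 1 - i) by omega, pow_add, mul_apply_eq_comp, S_pow_apply,
    Finset.prod_range_succ, show 2 * 16 ^ k - 1 - i + (i + 1) = 2 * 16 ^ k by omega,
    show 2 * 16 ^ k - 1 - i + i + 1 = 2 * 16 ^ k by omega,
    show i + 1 + (n - 1 - i) - 1 - i = n - 1 - i by omega]
  congr 2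
  rw [Finset.prod_eq_pow_card (b := 6), Finset.card_range]
  intro r hr
  rw [Finset.mem_range] at hr
  exact D.s_mark k _ (by omega) (by omega)

/-- Vectors near `x₀`, placed at the coordinate `0`, do not come back near it. -/
theorem not_recurrent {n : ℕ} (hn : 0 < n) {y : lp (fun _ : ℕ => X) p} (hy : ‖y‖ ≤ D.c / 10) :
    D.c / 10 < ‖(D.T ^ n) y - lp.single (E := fun _ : ℕ => X) p 0 D.x₀‖ := by
  by_contra! hTy
  have hc := D.c_pos
  have hc1 := D.c_le
  obtain ⟨k, hk, hnk⟩ : ∃ k, 16 ^ k ≤ n ∧ n < 16 ^ (k + 1) :=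
    ⟨Nat.log 16 n, Nat.pow_log_le_self 16 hn.ne', Nat.lt_pow_succ_log_self (by norm_num) n⟩
  set V := ∑ i ∈ Finset.range n, D.term k n i y with hV
  have hR : ‖(D.T ^ n) y - (D.S ^ n) y - V‖ ≤ D.c / 10 := by
    refine (D.norm_T_pow_sub_le hk hnk y).trans (le_trans ?_ hy)
    exact mul_le_of_le_one_left (norm_nonneg _) (pow_le_one₀ (by norm_num) (by norm_num))
  have hVapply (q : ℕ) : V q = ∑ i ∈ Finset.range n, D.term k n i y q := by
    rw [hV, lp.coeFn_sum, Finset.sum_apply]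
  have hRq (q : ℕ) : ‖(D.T ^ n) y q - (D.S ^ n) y q - V q‖ ≤ D.c / 10 :=
    (norm_apply_le _ q).trans hR
  have hTq (q : ℕ) : ‖(D.T ^ n) y q - lp.single (E := fun _ : ℕ => X) p 0 D.x₀ q‖ ≤ D.c / 10 :=
    (norm_apply_le _ q).trans hTy
  have hterm (i : ℕ) (hi : i ∈ Finset.range n) :
      ‖D.term k n i y 0‖ ≤ (2 / 5) / 2 / 2 ^ i := by
    rw [Finset.mem_range] at hi
    rcases le_or_gt (16 ^ k) i with hik | hik
    · rw [term, D.T_pow_u_eq_zero hik, smul_zero]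
      simp only [lp.coeFn_zero, Pi.zero_apply, norm_zero]
      positivity
    set q := 2 * 16 ^ k - 1 - i with hq
    have h1 := hRq q
    have h2 := hTq q
    have hVq : V q = 0 := by
      rw [hVapply]
      refine Finset.sum_eq_zero fun l _ => ?_
      rw [term, lp.coeFn_smul, Pi.smul_apply, D.T_pow_u_apply (by omega), smul_zero]
    rw [hVq, sub_zero] at h1
    rw [lp.single_apply_ne _ _ _ (by omega), sub_zero] at h2
    have h3 : ‖(D.S ^ n) y q‖ ≤ D.c / 5 := by
      have := norm_sub_norm_le ((D.S ^ n) y q) ((D.T ^ n) y q)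
      rw [norm_sub_rev] at this
      linarith
    rw [hq, D.S_pow_apply_mark hik hi, D.s_exit, norm_smul, norm_mul, norm_mul, norm_pow,
      norm_pow, norm_inv, RCLike.norm_ofNat, RCLike.norm_ofNat, RCLike.norm_ofReal,
      abs_of_nonneg (by positivity)] at h3
    set a := ‖(D.S ^ (n - 1 - i)) y (2 * 16 ^ k)‖
    have h4 : ‖D.term k n i y 0‖ ≤ 2⁻¹ ^ (8 * 16 ^ k) * a * (3 ^ i * ‖D.u k‖) := by
      rw [term, lp.coeFn_smul, Pi.smul_apply, norm_smul, norm_mul, norm_pow, norm_inv,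
        RCLike.norm_ofNat]
      gcongr
      · exact D.norm_φ_le _
      · exact D.norm_T_pow_apply_zero_le _ _
    refine h4.trans ?_
    set w : ℝ := 2⁻¹ ^ (8 * 16 ^ k)
    rw [show (6 : ℝ) = 2 * 3 by norm_num, mul_pow] at h3
    rw [le_div_iff₀ (by positivity)]
    refine le_of_mul_le_mul_left ?_ hc
    linarith
  have hV0 : ‖V 0‖ ≤ 2 / 5 := by
    rw [hVapply]
    calc _ ≤ ∑ i ∈ Finset.range n, (2 / 5 : ℝ) / 2 / 2 ^ i := norm_sum_le_of_le _ hterm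
      _ ≤ 2 / 5 := sum_le_hasSum _ (fun i _ => by positivity) (hasSum_geometric_two' _)
  have hS0 : (D.S ^ n) y 0 = 0 := by
    rw [S_pow_apply, Finset.prod_eq_zero (Finset.mem_range.2 hn), zero_smul]
    simpa using D.s_boundary 0
  have h1 := hRq 0
  have h2 := hTq 0
  rw [hS0, sub_zero] at h1
  rw [lp.single_apply_self] at h2
  have h3 : ‖D.x₀‖ ≤ ‖V 0‖ + ‖(D.T ^ n) y 0 - V 0‖ + ‖(D.T ^ n) y 0 - D.x₀‖ := by
    calc ‖D.x₀‖ = ‖V 0 + ((D.T ^ n) y 0 - V 0) - ((D.T ^ n) y 0 - D.x₀)‖ := by congr 1; abel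
      _ ≤ _ := (norm_sub_le _ _).trans (by gcongr; exact norm_add_le _ _)
  rw [D.norm_x₀] at h3
  linarith

theorem T_single_zero : D.T (lp.single (E := fun _ : ℕ => X) p 0 D.x₀) = 0 := by
  have := D.T_pow_apply_eq_zero (N := 1) (y := lp.single (E := fun _ : ℕ => X) p 0 D.x₀)
    (fun i hi => lp.single_apply_ne _ _ _ (by omega)) 1
  ext i
  simpa using this i (by omega)

theorem not_hypercyclic : ¬ ∃ x, Dense (Set.range fun n : ℕ => (D.T ^ n) x) := by
  rintro ⟨x, hx⟩
  set e := lp.single (E := fun _ : ℕ => X) p 0 D.x₀ with he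
  have hc := D.c_pos
  have hp0 : 0 < p := zero_lt_one.trans_le (Fact.out : 1 ≤ p)
  have hen : ‖e‖ = 1 := by rw [he, lp.norm_single hp0, D.norm_x₀]
  have : Nontrivial (lp (fun _ : ℕ => X) p) := ⟨e, 0, by rw [← norm_ne_zero_iff, hen]; simp⟩
  have := Module.punctured_nhds_neBot 𝕜 (lp (fun _ : ℕ => X) p)
  have key {a b : ℕ} (hab : a < b) (ha : ‖(D.T ^ a) x - e‖ ≤ D.c / 10) :
      D.c / 10 < ‖(D.T ^ b) x - e‖ := by
    have h := D.not_recurrent (Nat.sub_pos_of_lt hab) ha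
    have h0 : (D.T ^ (b - a)) e = 0 := by
      rw [show b - a = (b - a - 1) + 1 by omega, pow_succ, mul_apply_eq_comp, he,
        D.T_single_zero, map_zero]
    rwa [map_sub, h0, sub_zero, ← mul_apply_eq_comp, ← pow_add, Nat.sub_add_cancel hab.le] at h
  have hball : (Metric.ball e (D.c / 10)).Nonempty := ⟨e, Metric.mem_ball_self (by positivity)⟩
  obtain ⟨_, ⟨a, rfl⟩, ha⟩ := hx.exists_mem_open Metric.isOpen_ball hball
  obtain ⟨_, ⟨⟨b, rfl⟩, hba⟩, hb⟩ :=
    (hx.sdiff_singleton ((D.T ^ a) x)).exists_mem_open Metric.isOpen_ball hball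
  rw [Metric.mem_ball, dist_eq_norm] at ha hb
  rcases lt_trichotomy a b with hab | rfl | hab
  · exact (key hab ha.le).not_gt hb
  · exact hba rfl
  · exact (key hab hb.le).not_gt ha

theorem S_pow_single_of_lt {m t : ℕ} (h : t < m) (v : X) :
    (D.S ^ m) (lp.single (E := fun _ : ℕ => X) p t v) = 0 := by
  ext j
  rw [S_pow_apply, lp.single_apply_ne _ _ _ (by omega), smul_zero]
  rfl

theorem S_pow_single {m t : ℕ} (h : m ≤ t) (v : X) :
    (D.S ^ m) (lp.single (E := fun _ : ℕ => X) p t v) =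
      lp.single (E := fun _ : ℕ => X) p (t - m)
        ((∏ r ∈ Finset.range m, D.s (t - m + r + 1)) • v) := by
  ext j
  rw [S_pow_apply]
  rcases eq_or_ne j (t - m) with rfl | hj
  · rw [Nat.sub_add_cancel h, lp.single_apply_self, lp.single_apply_self]
  · rw [lp.single_apply_ne _ _ _ (by omega), lp.single_apply_ne _ _ _ hj, smul_zero]

theorem prod_chain {k m : ℕ} (hm : m < 14 * 16 ^ k) :
    ∏ r ∈ Finset.range m, D.s (2 * 16 ^ k + r + 1) = 2 ^ m := by
  rw [Finset.prod_eq_pow_card (b := 2), Finset.card_range]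
  intro r hr
  rw [Finset.mem_range] at hr
  exact D.s_chain k _ (by omega) (by rw [pow_succ]; omega)

/-- The vector placed at the top of the `k`-th chain. -/
noncomputable def top (k : ℕ) : lp (fun _ : ℕ => X) p :=
  lp.single (E := fun _ : ℕ => X) p (16 ^ (k + 1) - 1)
    ((2 * 2⁻¹ ^ (6 * 16 ^ k) : 𝕜) • D.x₀)

theorem norm_top (k : ℕ) : ‖D.top k‖ = 2 * 2⁻¹ ^ (6 * 16 ^ k) := by
  rw [top, lp.norm_single (zero_lt_one.trans_le (Fact.out : 1 ≤ p)), norm_smul, norm_mul,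
    norm_pow, norm_inv, RCLike.norm_ofNat, D.norm_x₀, mul_one]

theorem two_inv_pow_mul_pow_eq_one {𝔽 : Type*} [Field 𝔽] [CharZero 𝔽] (k : ℕ) :
    (2⁻¹ : 𝔽) ^ (8 * 16 ^ k) * (2 ^ (14 * 16 ^ k - 1) * (2 * 2⁻¹ ^ (6 * 16 ^ k))) = 1 := by
  have h : 14 * 16 ^ k - 1 + 1 = 8 * 16 ^ k + 6 * 16 ^ k := by
    have : 0 < 16 ^ k := by positivity
    omega
  rw [← mul_assoc (2 ^ (14 * 16 ^ k - 1)), ← pow_succ, h, pow_add, inv_pow, inv_pow]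
  field_simp

/-- The vector witnessing ε-hypercyclicity. -/
noncomputable def vec : lp (fun _ : ℕ => X) p := ∑' k, D.top k

theorem norm_top_le (k : ℕ) : ‖D.top k‖ ≤ 1 / 2 / 2 ^ k := by
  have hk := succ_le_sixteen_pow k
  rw [norm_top]
  calc (2 : ℝ) * 2⁻¹ ^ (6 * 16 ^ k) ≤ 2 * 2⁻¹ ^ (k + 2) := by
        gcongr ?_ * ?_
        exact pow_le_pow_of_le_one (by norm_num) (by norm_num) (by omega)
    _ = 1 / 2 / 2 ^ k := by rw [pow_add, inv_pow]; ring

theorem hasSum_vec [CompleteSpace X] : HasSum D.top D.vec :=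
  (Summable.of_norm_bounded (hasSum_geometric_two' 1).summable D.norm_top_le).hasSum

theorem hasSum_vec_apply [CompleteSpace X] (i : ℕ) :
    HasSum (fun k => D.top k i) (D.vec i) :=
  D.hasSum_vec.mapL (lp.evalCLM 𝕜 (fun _ : ℕ => X) p i)

theorem vec_apply_eq_zero [CompleteSpace X] {i : ℕ} (h : ∀ k, i ≠ 16 ^ (k + 1) - 1) :
    D.vec i = 0 := by
  refine (D.hasSum_vec_apply i).unique ?_
  convert hasSum_zero with k
  exact lp.single_apply_ne _ _ _ (h k)

theorem vec_apply_top [CompleteSpace X] (k : ℕ) :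
    D.vec (16 ^ (k + 1) - 1) = (2 * 2⁻¹ ^ (6 * 16 ^ k) : 𝕜) • D.x₀ := by
  have h := hasSum_single (f := fun l => D.top l (16 ^ (k + 1) - 1)) k fun l hl => by
    refine lp.single_apply_ne _ _ _ fun h => hl ?_
    have h1 : 0 < 16 ^ (k + 1) := by positivity
    have h2 : 0 < 16 ^ (l + 1) := by positivity
    have := Nat.pow_right_injective (le_refl 2 |>.trans (by norm_num : 2 ≤ 16))
      (show 16 ^ (k + 1) = 16 ^ (l + 1) by omega)
    omega
  exact (D.hasSum_vec_apply _).unique (by simpa [top] using h)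

theorem norm_S_pow_top (k : ℕ) : ‖(D.S ^ (14 * 16 ^ k)) (D.top k)‖ = D.c * ‖D.u k‖ := by
  have hpos : 0 < 16 ^ k := by positivity
  have hc := D.c_pos
  have h16 : 16 ^ (k + 1) = 16 * 16 ^ k := by ring
  rw [top, S_pow_single _ (by omega), lp.norm_single (zero_lt_one.trans_le (Fact.out : 1 ≤ p))]
  have hprod : ∏ r ∈ Finset.range (14 * 16 ^ k), D.s (16 ^ (k + 1) - 1 - 14 * 16 ^ k + r + 1) =
      2 ^ (14 * 16 ^ k - 1) * D.s (2 * 16 ^ k) := by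
    obtain ⟨m, hm⟩ : ∃ m, 14 * 16 ^ k = m + 1 := ⟨14 * 16 ^ k - 1, by omega⟩
    rw [hm, Finset.prod_range_succ', Nat.add_sub_cancel, ← D.prod_chain (k := k) (by omega)]
    congr 1
    · refine Finset.prod_congr rfl fun r _ => ?_
      congr 1
      omega
    · congr 1
      omega
  rw [hprod, smul_smul, norm_smul, D.norm_x₀, mul_one, D.s_exit]
  simp only [norm_mul, norm_pow, norm_inv, RCLike.norm_ofNat, RCLike.norm_ofReal, abs_mul,
    abs_norm, abs_of_pos hc]
  have := two_inv_pow_mul_pow_eq_one (𝔽 := ℝ) k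
  linear_combination D.c * ‖D.u k‖ * this

theorem norm_S_pow_vec_le [CompleteSpace X] (k : ℕ) :
    ‖(D.S ^ (14 * 16 ^ k)) D.vec‖ ≤ D.c * ‖D.u k‖ + 2⁻¹ ^ k := by
  have hpos : 0 < 16 ^ k := by positivity
  have h := (D.hasSum_vec.mapL (D.S ^ (14 * 16 ^ k))).update k 0
  rw [zero_sub, neg_add_eq_sub] at h
  have h' := h.norm_le_of_bounded (hasSum_geometric_two' (2⁻¹ ^ k)) fun j => by
    rcases lt_trichotomy j k with hj | rfl | hj
    · have := sixteen_pow_succ_le hj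
      rw [Function.update_of_ne hj.ne, top, S_pow_single_of_lt _ (by rw [pow_succ]; omega),
        norm_zero]
      positivity
    · rw [Function.update_self, norm_zero]
      positivity
    · rw [Function.update_of_ne hj.ne']
      have h1 := sixteen_pow_succ_le hj
      have h2 := succ_le_sixteen_pow j
      calc ‖(D.S ^ (14 * 16 ^ k)) (D.top j)‖
          ≤ 8 ^ (14 * 16 ^ k) * (2 * 2⁻¹ ^ (6 * 16 ^ j)) := by
            rw [← D.norm_top]; exact D.norm_S_pow_le _ _
        _ = 2 ^ (42 * 16 ^ k) * (2 * 2⁻¹ ^ (6 * 16 ^ j)) := by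
            rw [show (8 : ℝ) = 2 ^ 3 by norm_num, ← pow_mul]
            congr 2
            ring
        _ ≤ 2 ^ (42 * 16 ^ k) * (2 * 2⁻¹ ^ (42 * 16 ^ k + (k + 2 + j))) := by
            gcongr _ * (_ * ?_)
            exact pow_le_pow_of_le_one (by norm_num) (by norm_num) (by omega)
        _ = 2⁻¹ ^ k / 2 / 2 ^ j := by
            simp only [pow_add, inv_pow]
            field_simp
  have := norm_sub_norm_le ((D.S ^ (14 * 16 ^ k)) D.vec) ((D.S ^ (14 * 16 ^ k)) (D.top k))
  rw [norm_S_pow_top] at this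
  linarith

theorem sum_term_vec [CompleteSpace X] (k : ℕ) :
    ∑ i ∈ Finset.range (14 * 16 ^ k), D.term k (14 * 16 ^ k) i D.vec = D.u k := by
  have hpos : 0 < 16 ^ k := by positivity
  have h16 : 16 ^ (k + 1) = 16 * 16 ^ k := by ring
  rw [Finset.sum_eq_single_of_mem 0 (by rw [Finset.mem_range]; omega)]
  · rw [term, S_pow_apply, prod_chain _ (by omega),
      show 2 * 16 ^ k + (14 * 16 ^ k - 1 - 0) = 16 ^ (k + 1) - 1 by omega, vec_apply_top,
      smul_smul, map_smul, D.φ_x₀, smul_eq_mul, mul_one, Nat.sub_zero,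
      two_inv_pow_mul_pow_eq_one, one_smul, pow_zero]
    rfl
  · intro i hi hi0
    rw [Finset.mem_range] at hi
    rw [term, S_pow_apply, D.vec_apply_eq_zero]
    · simp
    · intro l hl
      rcases lt_trichotomy l k with h | rfl | h
      · have := sixteen_pow_succ_le h
        rw [pow_succ] at hl
        omega
      · omega
      · have := sixteen_pow_succ_le h
        rw [pow_succ 16 l] at hl
        omega

theorem norm_T_pow_vec_sub_le [CompleteSpace X] (k : ℕ) :
    ‖(D.T ^ (14 * 16 ^ k)) D.vec - D.u k‖ ≤ D.c * ‖D.u k‖ + 2⁻¹ ^ k * (‖D.vec‖ + 1) := by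
  have hpos : 0 < 16 ^ k := by positivity
  have h1 := D.norm_T_pow_sub_le (k := k) (n := 14 * 16 ^ k) (by omega)
    (by rw [pow_succ]; omega) D.vec
  rw [sum_term_vec, sub_right_comm] at h1
  have h2 := D.norm_S_pow_vec_le k
  have h3 : (2⁻¹ : ℝ) ^ (14 * 16 ^ k) * ‖D.vec‖ ≤ 2⁻¹ ^ k * ‖D.vec‖ := by
    gcongr ?_ * _
    refine pow_le_pow_of_le_one (by norm_num) (by norm_num) ?_
    have := succ_le_sixteen_pow k
    omega
  have h4 := norm_sub_norm_le ((D.T ^ (14 * 16 ^ k)) D.vec - D.u k) ((D.S ^ (14 * 16 ^ k)) D.vec)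
  linarith

/-- If the sequence `u` is dense along arbitrarily large indices, the perturbed shift is
ε-hypercyclic for every `ε > c`. -/
theorem eps_hypercyclic [CompleteSpace X]
    (hD : ∀ v, ∀ η > 0, ∀ k₀, ∃ k ≥ k₀, ‖D.u k - v‖ < η) {ε : ℝ} (hε : D.c < ε) :
    ∃ x, ∀ v, v ≠ 0 → ∃ n : ℕ, ‖(D.T ^ n) x - v‖ ≤ ε * ‖v‖ := by
  refine ⟨D.vec, fun v hv => ?_⟩
  have hc := D.c_pos
  have hc1 := D.c_le
  have hv' : 0 < ‖v‖ := norm_pos_iff.2 hv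
  set η := (ε - D.c) / 3 * ‖v‖ with hη
  have hη0 : 0 < η := by
    have : 0 < ε - D.c := sub_pos.2 hε
    positivity
  have hlim : Tendsto (fun k : ℕ => (2⁻¹ : ℝ) ^ k * (‖D.vec‖ + 1)) atTop (𝓝 0) := by
    simpa using (tendsto_pow_atTop_nhds_zero_of_lt_one (r := (2⁻¹ : ℝ)) (by norm_num)
      (by norm_num)).mul_const (‖D.vec‖ + 1)
  obtain ⟨k₀, hk₀⟩ := eventually_atTop.1 (hlim.eventually_lt_const hη0)
  obtain ⟨k, hk, hku⟩ := hD v η hη0 k₀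
  refine ⟨14 * 16 ^ k, ?_⟩
  have h1 := D.norm_T_pow_vec_sub_le k
  have h2 := hk₀ k hk
  have h3 := norm_sub_le_norm_sub_add_norm_sub ((D.T ^ (14 * 16 ^ k)) D.vec) (D.u k) v
  have h4 : ‖D.u k‖ ≤ ‖v‖ + η := by
    have := norm_sub_norm_le (D.u k) v
    linarith
  have h5 : D.c * ‖D.u k‖ ≤ D.c * ‖v‖ + η := by
    calc D.c * ‖D.u k‖ ≤ D.c * (‖v‖ + η) := by gcongr
      _ ≤ D.c * ‖v‖ + 1 * η := by rw [mul_add]; gcongr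
      _ = D.c * ‖v‖ + η := by rw [one_mul]
  have h6 : 3 * η = ε * ‖v‖ - D.c * ‖v‖ := by rw [hη]; ring
  linarith

end

end PerturbedShift

/-- For `p ∈ [1,∞)` and a nonzero separable Banach space `X`, the space `ℓᵖ(X)` admits, for
every `ε ∈ (0,1)`, a bounded operator which is ε-hypercyclic but not hypercyclic. -/
theorem lp_admits_eps_hypercyclic_not_hypercyclic
    {𝕜 X : Type*} [RCLike 𝕜] [NormedAddCommGroup X] [NormedSpace 𝕜 X]
    [CompleteSpace X] [TopologicalSpace.SeparableSpace X] [Nontrivial X]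
    (p : ℝ≥0∞) [Fact (1 ≤ p)] (hp : p ≠ ⊤)
    {ε : ℝ} (hε : ε ∈ Set.Ioo (0 : ℝ) 1) :
    ∃ T : lp (fun _ : ℕ => X) p →L[𝕜] lp (fun _ : ℕ => X) p,
      (∃ x, ∀ u, u ≠ 0 → ∃ n : ℕ, ‖(T ^ n) x - u‖ ≤ ε * ‖u‖) ∧
      ¬ ∃ x, Dense (Set.range fun n : ℕ => (T ^ n) x) := by
  obtain ⟨u, hu, hu', hdense⟩ := exists_frequently_dense_seq (X := X) hp
  obtain ⟨D, rfl, hc⟩ := PerturbedShift.exists_perturbedShift (𝕜 := 𝕜) hp u hu hu' (ε / 2)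
    (half_pos hε.1) (by linarith [hε.2])
  exact ⟨D.T, D.eps_hypercyclic hdense (by rw [hc]; exact half_lt_self hε.1), D.not_hypercyclic⟩
end

section
/- Let X be a nonzero separable Banach space. Then for every ε ∈ (0,1), the Banach space c₀(X) of all sequences (x_n) in X with ‖x_n‖ → 0, equipped with the supremum norm ‖(x_n)‖ = sup_n ‖x_n‖, admits a bounded linear operator that is ε-hypercyclic but not hypercyclic. -/
open Filter Topology

namespace ZeroAtInftyContinuousMap

variable {X : Type*} [NormedAddCommGroup X]

/-- A vanishing sequence, as an element of `C₀(ℕ, X)`. -/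
def ofTendsto (f : ℕ → X) (hf : ∀ δ > 0, ∃ N, ∀ p ≥ N, ‖f p‖ < δ) :
    ZeroAtInftyContinuousMap ℕ X where
  toFun := f
  continuous_toFun := continuous_of_discreteTopology
  zero_at_infty' := by
    rw [cocompact_eq_atTop, Metric.tendsto_atTop]
    simpa using hf

@[simp]
theorem ofTendsto_apply (f : ℕ → X) (hf) (p : ℕ) : ofTendsto f hf p = f p := rfl

/-- A finitely supported sequence, as an element of `C₀(ℕ, X)`. -/
def ofFiniteSupport (f : ℕ → X) (hf : ∃ N, ∀ p ≥ N, f p = 0) : ZeroAtInftyContinuousMap ℕ X :=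
  ofTendsto f fun δ hδ => hf.imp fun N hN p hp => by simpa [hN p hp] using hδ

@[simp]
theorem ofFiniteSupport_apply (f : ℕ → X) (hf) (p : ℕ) : ofFiniteSupport f hf p = f p := rfl

theorem exists_forall_norm_lt (z : ZeroAtInftyContinuousMap ℕ X) {δ : ℝ} (hδ : 0 < δ) :
    ∃ N, ∀ p ≥ N, ‖z p‖ < δ := by
  have h := z.zero_at_infty'
  rw [cocompact_eq_atTop, Metric.tendsto_atTop] at h
  simpa using h δ hδ

theorem norm_le_iff (z : ZeroAtInftyContinuousMap ℕ X) {C : ℝ} (hC : 0 ≤ C) :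
    ‖z‖ ≤ C ↔ ∀ p, ‖z p‖ ≤ C := by
  rw [← norm_toBCF_eq_norm, BoundedContinuousFunction.norm_le hC]
  rfl

theorem norm_apply_le (z : ZeroAtInftyContinuousMap ℕ X) (p : ℕ) : ‖z p‖ ≤ ‖z‖ :=
  (norm_le_iff z (norm_nonneg z)).1 le_rfl p

/-- The finitely supported sequence whose terms are prescribed terms of a dense sequence. -/
noncomputable def simpleSeq [TopologicalSpace.SeparableSpace X] (s : Σ N : ℕ, Fin N → ℕ) :
    ZeroAtInftyContinuousMap ℕ X :=
  ofFiniteSupport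
    (fun p => if h : p < s.1 then TopologicalSpace.denseSeq X (s.2 ⟨p, h⟩) else 0)
    ⟨s.1, fun _ hp => dif_neg hp.not_gt⟩

theorem simpleSeq_eq_zero [TopologicalSpace.SeparableSpace X] (s : Σ N : ℕ, Fin N → ℕ) {p : ℕ}
    (hp : s.1 ≤ p) : (simpleSeq s : ZeroAtInftyContinuousMap ℕ X) p = 0 :=
  dif_neg hp.not_gt

theorem exists_norm_simpleSeq_sub_le [TopologicalSpace.SeparableSpace X]
    (z : ZeroAtInftyContinuousMap ℕ X) {δ : ℝ} (hδ : 0 < δ) :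
    ∃ s, ‖simpleSeq s - z‖ ≤ δ := by
  obtain ⟨N, hN⟩ := exists_forall_norm_lt z hδ
  have h (x : X) : ∃ k, dist x (TopologicalSpace.denseSeq X k) < δ :=
    (TopologicalSpace.denseRange_denseSeq X).exists_dist_lt x hδ
  choose k hk using h
  refine ⟨⟨N, fun i => k (z i)⟩, (norm_le_iff _ hδ.le).2 fun p => ?_⟩
  by_cases hp : p < N
  · simpa [simpleSeq, hp, dist_eq_norm, norm_sub_rev] using (hk (z p)).le
  · simpa [simpleSeq, hp] using (hN p (not_lt.1 hp)).le

variable {𝕜 : Type*} [RCLike 𝕜] [NormedSpace 𝕜 X]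

/-- The action on sequences of the weighted backward shift with operator weights. A sequence is
indexed by pairs `(m, l)` through `Nat.pair`. The shift acts on the index `m`, and at the crossing
`m + 1 = l` it resets the growth of the `l`-th column and feeds in the column `0`. -/
noncomputable def shiftFun (c : 𝕜) (z : ℕ → X) (p : ℕ) : X :=
  if p.unpair.1 + 1 = p.unpair.2 then
    ((2 : 𝕜) / 2 ^ p.unpair.2) • z (Nat.pair (p.unpair.1 + 1) p.unpair.2) +
      (2 * c) • z (Nat.pair (p.unpair.1 + 1) 0)
  else (2 : 𝕜) • z (Nat.pair (p.unpair.1 + 1) p.unpair.2)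

theorem norm_two_div_two_pow_le (l : ℕ) : ‖(2 : 𝕜) / 2 ^ l‖ ≤ 2 := by
  rw [norm_div, norm_pow, RCLike.norm_two]
  exact div_le_self (by norm_num) (one_le_pow₀ (by norm_num))

theorem norm_shiftFun_le (c : 𝕜) (z : ℕ → X) (p : ℕ) {C : ℝ} (hC : 0 ≤ C)
    (h₁ : ‖z (Nat.pair (p.unpair.1 + 1) p.unpair.2)‖ ≤ C)
    (h₂ : p.unpair.1 + 1 = p.unpair.2 → ‖z (Nat.pair (p.unpair.1 + 1) 0)‖ ≤ C) :
    ‖shiftFun c z p‖ ≤ (2 + 2 * ‖c‖) * C := by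
  unfold shiftFun
  split_ifs with h
  · refine (norm_add_le _ _).trans ?_
    rw [norm_smul, norm_smul, norm_mul, RCLike.norm_two, add_mul]
    gcongr
    · exact norm_two_div_two_pow_le _
    · exact h₂ h
  · rw [norm_smul, RCLike.norm_two]
    nlinarith [norm_nonneg c, mul_nonneg (norm_nonneg c) hC]

theorem exists_forall_norm_shiftFun_lt (c : 𝕜) (z : ZeroAtInftyContinuousMap ℕ X) (δ : ℝ)
    (hδ : δ > 0) : ∃ N, ∀ p ≥ N, ‖shiftFun c z p‖ < δ := by
  have hc : 0 < 2 + 2 * ‖c‖ := by positivity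
  obtain ⟨N, hN⟩ := exists_forall_norm_lt z (δ := δ / (2 + 2 * ‖c‖) / 2) (by positivity)
  refine ⟨(N + 1) ^ 2, fun p hp => ?_⟩
  have hpp := Nat.pair_unpair p
  have key : ‖shiftFun c z p‖ ≤ (2 + 2 * ‖c‖) * (δ / (2 + 2 * ‖c‖) / 2) := by
    refine norm_shiftFun_le c z p (by positivity) (hN _ ?_).le fun h => (hN _ ?_).le
    · have := Nat.pair_lt_pair_left p.unpair.2 (Nat.lt_succ_self p.unpair.1)
      simp only [Nat.succ_eq_add_one] at this
      nlinarith
    · refine le_trans ?_ (Nat.left_le_pair _ _)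
      have := Nat.pair_lt_max_add_one_sq p.unpair.1 p.unpair.2
      rw [hpp, max_eq_right (by omega)] at this
      rw [h]
      have := lt_of_pow_lt_pow_left₀ 2 (by omega) (hp.trans_lt this)
      omega
  have : (2 + 2 * ‖c‖) * (δ / (2 + 2 * ‖c‖) / 2) = δ / 2 := by field_simp
  linarith

/-- The operator `shiftFun` on `C₀(ℕ, X)`. -/
noncomputable def shift (c : 𝕜) :
    ZeroAtInftyContinuousMap ℕ X →L[𝕜] ZeroAtInftyContinuousMap ℕ X :=
  LinearMap.mkContinuous
    { toFun := fun z => ofTendsto (shiftFun c z) (exists_forall_norm_shiftFun_lt c z)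
      map_add' := fun y z => by
        ext p
        simp only [ofTendsto_apply, add_apply, shiftFun]
        split_ifs
        · simp only [smul_add]; abel
        · simp only [smul_add]
      map_smul' := fun a z => by
        ext p
        simp only [ofTendsto_apply, smul_apply, shiftFun, RingHom.id_apply]
        split_ifs
        · simp only [smul_add, smul_comm a]
        · simp only [smul_comm a] }
    (2 + 2 * ‖c‖)
    (fun z => (norm_le_iff _ (by positivity)).2 fun p =>
      norm_shiftFun_le c z p (norm_nonneg z) (norm_apply_le z _) fun _ => norm_apply_le z _)

theorem shift_apply_pair (c : 𝕜) (z : ZeroAtInftyContinuousMap ℕ X) (m l : ℕ) :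
    shift c z (Nat.pair m l) = if m + 1 = l then
      ((2 : 𝕜) / 2 ^ l) • z (Nat.pair (m + 1) l) + (2 * c) • z (Nat.pair (m + 1) 0)
      else (2 : 𝕜) • z (Nat.pair (m + 1) l) := by
  change shiftFun c z (Nat.pair m l) = _
  simp [shiftFun]

theorem shift_pow_apply_pair (c : 𝕜) (n : ℕ) (z : ZeroAtInftyContinuousMap ℕ X) (m l : ℕ) :
    (shift c ^ n) z (Nat.pair m l) = if m < l ∧ l ≤ m + n then
      ((2 : 𝕜) ^ n / 2 ^ l) • z (Nat.pair (m + n) l) + (2 ^ n * c) • z (Nat.pair (m + n) 0)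
      else (2 : 𝕜) ^ n • z (Nat.pair (m + n) l) := by
  induction n generalizing m l with
  | zero =>
    rw [if_neg (by omega)]
    simp
  | succ n ih =>
    rw [pow_succ' (shift c), mul_apply_eq_comp, shift_apply_pair, ih, ih,
      show m + 1 + n = m + (n + 1) by ring]
    rcases eq_or_ne (m + 1) l with h | h
    · rw [if_pos h, if_neg (by omega), if_neg (by omega), if_pos (by omega), smul_smul, smul_smul]
      congr 2 <;> ring
    · by_cases h' : m < l ∧ l ≤ m + (n + 1)
      · rw [if_neg h, if_pos (by omega), if_pos h', smul_add, smul_smul, smul_smul]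
        congr 2 <;> ring
      · rw [if_neg h, if_neg (by omega), if_neg h', smul_smul]
        congr 1
        ring

theorem shift_pow_apply_eq_zero (c : 𝕜) {N n : ℕ} {z : ZeroAtInftyContinuousMap ℕ X}
    (hz : ∀ p ≥ N, z p = 0) (hn : N ≤ n) : (shift c ^ n) z = 0 := by
  ext p
  have h (k l : ℕ) : z (Nat.pair (k + n) l) = 0 :=
    hz _ (hn.trans ((Nat.le_add_left n k).trans (Nat.left_le_pair _ _)))
  rw [← Nat.pair_unpair p, shift_pow_apply_pair, h, h]
  simp

/-- Finitely supported vectors have small approximate preimages under high powers of `shift c`. -/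
theorem exists_norm_shift_pow_sub_le (c : 𝕜) {N : ℕ} {y : ZeroAtInftyContinuousMap ℕ X}
    (hy : ∀ p ≥ N, y p = 0) (n : ℕ) :
    ∃ u : ZeroAtInftyContinuousMap ℕ X, ‖u‖ ≤ 2 ^ N * (1 + ‖c‖) * ‖y‖ * (1 / 2) ^ n ∧
      ‖(shift c ^ n) u - y‖ ≤ ‖c‖ * ‖y‖ := by
  have hy' (m l : ℕ) (h : N ≤ m ∨ N ≤ l) : y (Nat.pair m l) = 0 :=
    hy _ (h.elim (fun h => h.trans (Nat.left_le_pair m l)) fun h => h.trans (Nat.right_le_pair m l))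
  let v : ℕ → ℕ → X := fun m l =>
    if l < N then
      if m < l ∧ l ≤ m + n then
        ((2 : 𝕜) ^ l / 2 ^ n) • (y (Nat.pair m l) - c • y (Nat.pair m 0))
      else ((2 : 𝕜) ^ n)⁻¹ • y (Nat.pair m l)
    else 0
  have hv (m l : ℕ) (h : N ≤ m ∨ N ≤ l) : v m l = 0 := by
    by_cases hl : l < N
    · have hm : N ≤ m := h.resolve_right (by omega)
      simp [v, hy' _ _ (Or.inl hm)]
    · exact if_neg hl
  have hv_norm (m l : ℕ) : ‖v m l‖ ≤ 2 ^ N * (1 + ‖c‖) * ‖y‖ * (1 / 2) ^ n := by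
    have hpos : 0 ≤ 2 ^ N * (1 + ‖c‖) * ‖y‖ * (1 / 2 : ℝ) ^ n := by positivity
    simp only [v]
    split_ifs with hl hml
    · calc _ ≤ (2 : ℝ) ^ l / 2 ^ n * (‖y‖ + ‖c‖ * ‖y‖) := by
            rw [norm_smul, norm_div, norm_pow, norm_pow, RCLike.norm_two]
            gcongr
            refine (norm_sub_le _ _).trans ?_
            rw [norm_smul]
            gcongr <;> exact norm_apply_le y _
        _ = 2 ^ l * (1 + ‖c‖) * ‖y‖ * (1 / 2) ^ n := by
            rw [div_pow, one_pow]; ring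
        _ ≤ _ := by
            gcongr
            norm_num
    · calc _ ≤ 1 * 1 * ‖y‖ * (1 / 2 : ℝ) ^ n := by
            rw [norm_smul, norm_inv, norm_pow, RCLike.norm_two, div_pow, one_pow, one_mul, one_mul,
              mul_comm, one_div]
            gcongr
            exact norm_apply_le y _
        _ ≤ _ := by
            gcongr
            · exact one_le_pow₀ (by norm_num)
            · linarith [norm_nonneg c]
    · simpa using hpos
  let u : ZeroAtInftyContinuousMap ℕ X := ofFiniteSupport
    (fun p => if n ≤ p.unpair.1 then v (p.unpair.1 - n) p.unpair.2 else 0)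
    ⟨(n + N + 1) ^ 2, fun p hp => by
      split_ifs with h
      · refine hv _ _ ?_
        by_contra! hlt
        have := Nat.pair_lt_max_add_one_sq p.unpair.1 p.unpair.2
        rw [Nat.pair_unpair] at this
        have := lt_of_pow_lt_pow_left₀ 2 (by omega) (hp.trans_lt this)
        omega
      · rfl⟩
  have hu (m l : ℕ) : u (Nat.pair (m + n) l) = v m l := by simp [u]
  refine ⟨u, (norm_le_iff _ (by positivity)).2 fun p => ?_,
    (norm_le_iff _ (by positivity)).2 fun p => ?_⟩
  · simp only [u, ofFiniteSupport_apply]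
    split_ifs
    · exact hv_norm _ _
    · rw [norm_zero]
      positivity
  · rw [← Nat.pair_unpair p]
    generalize p.unpair.1 = m
    generalize p.unpair.2 = l
    rw [sub_apply, shift_pow_apply_pair, hu, hu]
    have h₀ : (2 : 𝕜) ≠ 0 := two_ne_zero
    by_cases hl : l < N
    · have hexact : (if m < l ∧ l ≤ m + n then
          ((2 : 𝕜) ^ n / 2 ^ l) • v m l + (2 ^ n * c) • v m 0
          else (2 : 𝕜) ^ n • v m l) - y (Nat.pair m l) = 0 := by
        have hN : 0 < N := by omega
        by_cases h : m < l ∧ l ≤ m + n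
        · simp only [v, hl, h, hN, if_true, and_self, not_lt_zero, false_and, if_false, smul_smul]
          rw [show (2 : 𝕜) ^ n / 2 ^ l * (2 ^ l / 2 ^ n) = 1 by field_simp,
            show (2 : 𝕜) ^ n * c * (2 ^ n)⁻¹ = c by field_simp]
          simp
        · simp only [v, hl, h, if_true, if_false, smul_smul]
          rw [mul_inv_cancel₀ (pow_ne_zero n h₀)]
          simp
      rw [hexact, norm_zero]
      positivity
    · rw [hy' m l (Or.inr (by omega)), hv m l (Or.inr (by omega)), sub_zero]
      split_ifs
      · by_cases hN : 0 < N
        · simp only [v, hN, if_true, not_lt_zero, false_and, if_false, smul_smul]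
          rw [show (2 : 𝕜) ^ n * c * (2 ^ n)⁻¹ = c by field_simp, smul_zero, zero_add, norm_smul]
          gcongr
          exact norm_apply_le y _
        · rw [hv m 0 (Or.inr (by omega))]
          simp only [smul_zero, add_zero, norm_zero]
          positivity
      · rw [smul_zero, norm_zero]
        positivity

theorem dense_setOf_exists_norm_shift_pow_sub_lt [TopologicalSpace.SeparableSpace X] {c : 𝕜}
    {η : ℝ} (hη : ‖c‖ < η) {N : ℕ} {y : ZeroAtInftyContinuousMap ℕ X} (hy : ∀ p ≥ N, y p = 0)
    (hy₀ : y ≠ 0) : Dense {x | ∃ n : ℕ, ‖(shift c ^ n) x - y‖ < η * ‖y‖} := by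
  refine Metric.dense_iff.2 fun z r hr => ?_
  obtain ⟨s, hs⟩ := exists_norm_simpleSeq_sub_le z (half_pos (half_pos hr))
  have hlim : Tendsto (fun n : ℕ => 2 ^ N * (1 + ‖c‖) * ‖y‖ * (1 / 2 : ℝ) ^ n) atTop (𝓝 0) := by
    simpa using (tendsto_pow_atTop_nhds_zero_of_lt_one (r := (1 / 2 : ℝ)) (by norm_num)
      (by norm_num)).const_mul (2 ^ N * (1 + ‖c‖) * ‖y‖)
  obtain ⟨n, hn, hsn⟩ :=
    ((hlim.eventually_lt_const (half_pos hr)).and (eventually_ge_atTop s.1)).exists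
  obtain ⟨u, hu, huy⟩ := exists_norm_shift_pow_sub_le c hy n
  refine ⟨simpleSeq s + u, ?_, n, ?_⟩
  · rw [mem_ball_iff_norm, add_sub_right_comm]
    linarith [norm_add_le (simpleSeq s - z) u]
  · rw [map_add, shift_pow_apply_eq_zero c (fun p hp => simpleSeq_eq_zero s hp) hsn, zero_add]
    exact huy.trans_lt (mul_lt_mul_of_pos_right hη (norm_pos_iff.2 hy₀))

theorem exists_norm_shift_pow_sub_le_of_norm_lt [TopologicalSpace.SeparableSpace X]
    [CompleteSpace X] {c : 𝕜} {η ε : ℝ} (hη : ‖c‖ < η) (hε : η < ε) :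
    ∃ x : ZeroAtInftyContinuousMap ℕ X, ∀ u, u ≠ 0 →
      ∃ n : ℕ, ‖(shift c ^ n) x - u‖ ≤ ε * ‖u‖ := by
  have hη₀ : 0 < η := (norm_nonneg c).trans_lt hη
  have hdense : Dense (⋂ s : {s : Σ N : ℕ, Fin N → ℕ //
      (simpleSeq s : ZeroAtInftyContinuousMap ℕ X) ≠ 0},
      {x : ZeroAtInftyContinuousMap ℕ X |
        ∃ n : ℕ, ‖(shift c ^ n) x - simpleSeq s.1‖ < η * ‖simpleSeq (X := X) s.1‖}) := by
    refine dense_iInter_of_isOpen (fun s => ?_) fun s =>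
      dense_setOf_exists_norm_shift_pow_sub_lt hη (fun p hp => simpleSeq_eq_zero s.1 hp) s.2
    simp only [Set.ofPred_exists]
    exact isOpen_iUnion fun n => isOpen_lt (by fun_prop) continuous_const
  obtain ⟨x, hx⟩ := hdense.nonempty
  refine ⟨x, fun u hu => ?_⟩
  have hu₀ : 0 < ‖u‖ := norm_pos_iff.2 hu
  obtain ⟨κ, hκ₀, hκ₁, hκ⟩ : ∃ κ : ℝ, 0 < κ ∧ κ < 1 ∧ η * (1 + κ) + κ ≤ ε := by
    refine ⟨min (1 / 2) ((ε - η) / (1 + η)), ?_, ?_, ?_⟩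
    · have : 0 < ε - η := sub_pos.2 hε
      positivity
    · exact (min_le_left _ _).trans_lt (by norm_num)
    · have h := min_le_right (1 / 2) ((ε - η) / (1 + η))
      rw [le_div_iff₀ (by linarith)] at h
      linarith
  obtain ⟨s, hs⟩ := exists_norm_simpleSeq_sub_le u (mul_pos hκ₀ hu₀)
  have hs₀ : (simpleSeq s : ZeroAtInftyContinuousMap ℕ X) ≠ 0 := by
    intro h
    rw [h, zero_sub, norm_neg] at hs
    nlinarith
  obtain ⟨n, hn⟩ := Set.mem_iInter.1 hx ⟨s, hs₀⟩
  refine ⟨n, ?_⟩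
  have h₁ : ‖simpleSeq (X := X) s‖ ≤ (1 + κ) * ‖u‖ := by
    linarith [norm_sub_norm_le (simpleSeq s) u]
  calc ‖(shift c ^ n) x - u‖
      ≤ ‖(shift c ^ n) x - simpleSeq s‖ + ‖simpleSeq s - u‖ := norm_sub_le_norm_sub_add_norm_sub ..
    _ ≤ η * ((1 + κ) * ‖u‖) + κ * ‖u‖ := by
        gcongr
        exact hn.le.trans (by gcongr)
    _ = (η * (1 + κ) + κ) * ‖u‖ := by ring
    _ ≤ ε * ‖u‖ := by gcongr

theorem not_dense_range_shift_pow [Nontrivial X] {c : 𝕜} (hc : c ≠ 0)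
    (z : ZeroAtInftyContinuousMap ℕ X) : ¬ Dense (Set.range fun n : ℕ => (shift c ^ n) z) := by
  intro hz
  have hc₀ : 0 < ‖c‖ := norm_pos_iff.2 hc
  obtain ⟨x, hx⟩ := NormedSpace.exists_lt_norm 𝕜 X (1 + ‖z‖ + (1 + ‖z‖) / ‖c‖)
  let w : ZeroAtInftyContinuousMap ℕ X := ofFiniteSupport (fun p => if p = 0 then x else 0)
    ⟨1, fun p hp => if_neg (by omega)⟩
  obtain ⟨_, hball, n, rfl⟩ := Metric.dense_iff.1 hz w 1 one_pos
  rw [mem_ball_iff_norm] at hball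
  have happ (l : ℕ) : ‖(shift c ^ n) z (Nat.pair 0 l) - w (Nat.pair 0 l)‖ ≤ 1 :=
    (norm_apply_le ((shift c ^ n) z - w) _).trans hball.le
  have h₀ := happ 0
  have hn := happ n
  rw [shift_pow_apply_pair, if_neg (by omega), zero_add] at h₀
  have hw₀ : w (Nat.pair 0 0) = x := by simp [w, Nat.pair]
  rw [hw₀] at h₀
  rcases Nat.eq_zero_or_pos n with rfl | hpos
  · rw [pow_zero, one_smul] at h₀
    have := norm_sub_norm_le x (z (Nat.pair 0 0))
    rw [norm_sub_rev] at this
    have : 0 ≤ (1 + ‖z‖) / ‖c‖ := by positivity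
    linarith [norm_apply_le z (Nat.pair 0 0)]
  · have hwn : w (Nat.pair 0 n) = 0 :=
      if_neg (hpos.trans_le (Nat.right_le_pair 0 n)).ne'
    rw [shift_pow_apply_pair, if_pos (by omega), hwn, sub_zero, zero_add,
      div_self (pow_ne_zero n two_ne_zero), one_smul, mul_comm, mul_smul] at hn
    set a : X := (2 : 𝕜) ^ n • z (Nat.pair n 0)
    have h₁ : ‖x‖ ≤ ‖a‖ + 1 := by
      have := norm_sub_norm_le x a
      rw [norm_sub_rev] at this
      linarith
    have h₂ : ‖c‖ * ‖a‖ ≤ 1 + ‖z‖ := by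
      have := norm_sub_norm_le (c • a) (-z (Nat.pair n n))
      rw [sub_neg_eq_add, add_comm (c • a), norm_neg, norm_smul] at this
      linarith [norm_apply_le z (Nat.pair n n)]
    rw [mul_comm, ← le_div_iff₀ hc₀] at h₂
    linarith [norm_nonneg z]

end ZeroAtInftyContinuousMap

/-- For a nonzero separable Banach space `X`, the space `c₀(X)` of sequences in `X` tending
to `0` in norm (with the sup norm), here realized as `C₀(ℕ, X)`, admits, for every
`ε ∈ (0,1)`, a bounded operator which is ε-hypercyclic but not hypercyclic. -/
theorem c0_admits_eps_hypercyclic_not_hypercyclic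
    {𝕜 X : Type*} [RCLike 𝕜] [NormedAddCommGroup X] [NormedSpace 𝕜 X]
    [CompleteSpace X] [TopologicalSpace.SeparableSpace X] [Nontrivial X]
    {ε : ℝ} (hε : ε ∈ Set.Ioo (0 : ℝ) 1) :
    ∃ T : ZeroAtInftyContinuousMap ℕ X →L[𝕜] ZeroAtInftyContinuousMap ℕ X,
      (∃ x, ∀ u, u ≠ 0 → ∃ n : ℕ, ‖(T ^ n) x - u‖ ≤ ε * ‖u‖) ∧
      ¬ ∃ x, Dense (Set.range fun n : ℕ => (T ^ n) x) := by
  obtain ⟨c, hc₀, hc⟩ := NormedField.exists_norm_lt 𝕜 (half_pos hε.1)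
  exact ⟨ZeroAtInftyContinuousMap.shift c,
    ZeroAtInftyContinuousMap.exists_norm_shift_pow_sub_le_of_norm_lt hc (half_lt_self hε.1),
    fun ⟨z, hz⟩ => ZeroAtInftyContinuousMap.not_dense_range_shift_pow (norm_pos_iff.1 hc₀) z hz⟩
end
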